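/- arXiv:1810.05928 — 9 statements merged into one kernel-verified Lean document; each statement's English description precedes it below -/
import Mathlib

section
/- Let (ψ, n) be a classical L-periodic solution of the exciton–polariton system on [0,∞) with α = β and ε = 1. Then the total mass satisfies the exact identity M(t) = e^{−αt}·(M(0) − P·L/α) + P·L/α for all t ≥ 0, and consequently M(t) → P·L/α as t → +∞. -/
section
open MeasureTheory Set Filter Topology

theorem xp_cs {E : Type*} [NormedAddCommGroup E] [NormedSpace ℝ E] (μ s : ℝ) {S : Set ℝ}
    {h : ℝ → E} (hh : ContinuousOn h S) :
    ContinuousOn (fun t => Real.exp (-(μ * (t - s))) • h t) S :=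
  ContinuousOn.smul (f := fun t => Real.exp (-(μ * (t - s)))) (by fun_prop) hh

/-- Laplace weight -/
noncomputable def xpHat {E : Type*} [NormedAddCommGroup E] [NormedSpace ℝ E]
    (μ s b : ℝ) (h : ℝ → E) : E :=
  ∫ t in s..b, Real.exp (-(μ * (t - s))) • h t

noncomputable def xpLap {E : Type*} [NormedAddCommGroup E] [NormedSpace ℝ E]
    (μ s b : ℝ) (g : ℝ → E) : E :=
  μ • xpHat μ s b (fun t => g t - g s) + Real.exp (-(μ * (b - s))) • (g b - g s)

theorem xpLap_eq_hat {E : Type*} [NormedAddCommGroup E] [NormedSpace ℝ E] [CompleteSpace E]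
    (μ s b : ℝ) (hsb : s ≤ b) (g h : ℝ → E) (hg : ContinuousOn g (Icc s b))
    (hh : ContinuousOn h (Icc s b))
    (hd : ∀ t ∈ Ioo s b, HasDerivAt g (h t) t) :
    xpLap μ s b g = xpHat μ s b h := by
  have key : ∫ t in s..b, (Real.exp (-(μ * (t - s))) • h t
      - μ • (Real.exp (-(μ * (t - s))) • (g t - g s)))
      = Real.exp (-(μ * (b - s))) • (g b - g s) - Real.exp (-(μ * (s - s))) • (g s - g s) := by
    apply intervalIntegral.integral_eq_sub_of_hasDerivAt_of_le hsb
      (f := fun t => Real.exp (-(μ * (t - s))) • (g t - g s))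
    · exact ContinuousOn.smul (by fun_prop) (hg.sub continuousOn_const)
    · intro t ht
      have h1 : HasDerivAt (fun t => Real.exp (-(μ * (t - s))))
          (Real.exp (-(μ * (t - s))) * (-(μ * 1))) t :=
        (((((hasDerivAt_id t).sub_const s)).const_mul μ).neg).exp
      have h2 := h1.smul ((hd t ht).sub_const (g s))
      refine HasDerivAt.congr_deriv h2 ?_
      symm
      rw [smul_smul, sub_eq_add_neg, ← neg_smul]
      congr 2
      ring
    · apply ContinuousOn.intervalIntegrable_of_Icc hsb
      apply ContinuousOn.sub
      · exact xp_cs μ s hh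
      · exact ContinuousOn.const_smul (xp_cs μ s (hg.sub continuousOn_const)) _
  rw [intervalIntegral.integral_sub, intervalIntegral.integral_smul] at key
  · simp only [sub_self, smul_zero, sub_zero] at key
    unfold xpLap xpHat
    rw [← key]; abel
  · exact ContinuousOn.intervalIntegrable_of_Icc hsb (xp_cs μ s hh)
  · exact ContinuousOn.intervalIntegrable_of_Icc hsb
      (ContinuousOn.const_smul (xp_cs μ s (hg.sub continuousOn_const)) _)

theorem xpHat_mono (μ s b : ℝ) (hsb : s ≤ b) (g h : ℝ → ℝ) (hg : ContinuousOn g (Icc s b))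
    (hh : ContinuousOn h (Icc s b)) (hle : ∀ t ∈ Icc s b, g t ≤ h t) :
    xpHat μ s b g ≤ xpHat μ s b h := by
  unfold xpHat
  apply intervalIntegral.integral_mono_on hsb
  · exact ContinuousOn.intervalIntegrable_of_Icc hsb (xp_cs μ s hg)
  · exact ContinuousOn.intervalIntegrable_of_Icc hsb (xp_cs μ s hh)
  · intro t ht
    exact mul_le_mul_of_nonneg_left (hle t ht) (Real.exp_nonneg _)

theorem xpHat_one (μ s b : ℝ) (hμ : μ ≠ 0) :
    xpHat μ s b (fun _ => (1:ℝ)) = (1 - Real.exp (-(μ * (b - s)))) / μ := by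
  unfold xpHat
  have : ∀ t ∈ uIcc s b, HasDerivAt (fun t => - Real.exp (-(μ * (t - s))) / μ)
      (Real.exp (-(μ * (t - s))) • (1:ℝ)) t := by
    intro t _
    have h1 : HasDerivAt (fun t => Real.exp (-(μ * (t - s))))
          (Real.exp (-(μ * (t - s))) * (-(μ * 1))) t :=
        (((((hasDerivAt_id t).sub_const s)).const_mul μ).neg).exp
    refine HasDerivAt.congr_deriv (h1.neg.div_const μ) ?_
    simp only [smul_eq_mul]; field_simp
  rw [intervalIntegral.integral_eq_sub_of_hasDerivAt this]
  · simp; ring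
  · apply Continuous.intervalIntegrable; fun_prop

theorem xpHat_norm_le {E : Type*} [NormedAddCommGroup E] [NormedSpace ℝ E]
    (μ s b : ℝ) (hμ : 0 < μ) (hsb : s ≤ b) (h : ℝ → E) (B : ℝ) (hB0 : 0 ≤ B)
    (hB : ∀ t ∈ Icc s b, ‖h t‖ ≤ B) : ‖xpHat μ s b h‖ ≤ B / μ := by
  have h1 : ‖xpHat μ s b h‖ ≤ ∫ t in s..b, Real.exp (-(μ * (t - s))) * B := by
    unfold xpHat
    apply intervalIntegral.norm_integral_le_of_norm_le hsb
    · refine Eventually.of_forall fun t ht => ?_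
      rw [norm_smul, Real.norm_eq_abs, abs_of_pos (Real.exp_pos _)]
      exact mul_le_mul_of_nonneg_left (hB t (Ioc_subset_Icc_self ht)) (Real.exp_nonneg _)
    · apply Continuous.intervalIntegrable; fun_prop
  have h2 : ∫ t in s..b, Real.exp (-(μ * (t - s))) * B
      = (1 - Real.exp (-(μ * (b - s)))) / μ * B := by
    rw [intervalIntegral.integral_mul_const, ← xpHat_one μ s b hμ.ne']
    simp [xpHat]
  rw [h2] at h1
  refine h1.trans ?_
  rw [div_mul_eq_mul_div]
  gcongr
  have := Real.exp_pos (-(μ * (b - s)))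
  nlinarith

theorem xp_tendsto_exp (c : ℝ) (hc : 0 < c) :
    Tendsto (fun μ : ℝ => Real.exp (-(μ * c))) atTop (𝓝 0) := by
  apply Real.tendsto_exp_neg_atTop_nhds_zero.comp
  exact tendsto_id.atTop_mul_const hc

/-- Abel limit -/
theorem xpHat_tendsto {E : Type*} [NormedAddCommGroup E] [NormedSpace ℝ E] [CompleteSpace E]
    (s b : ℝ) (hsb : s < b) (h : ℝ → E) (hh : ContinuousOn h (Icc s b)) :
    Tendsto (fun μ : ℝ => μ • xpHat μ s b h) atTop (𝓝 (h s)) := by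
  obtain ⟨B, hB⟩ := isCompact_Icc.exists_bound_of_continuousOn hh
  have hB0 : 0 ≤ B := (norm_nonneg _).trans (hB s ⟨le_rfl, hsb.le⟩)
  -- difference
  have hdiff : ∀ μ : ℝ, 0 < μ → μ • xpHat μ s b h
      = μ • xpHat μ s b (fun t => h t - h s) + (1 - Real.exp (-(μ * (b - s)))) • h s := by
    intro μ hμ
    have e1 : xpHat μ s b (fun t => h t - h s) = xpHat μ s b h
        - xpHat μ s b (fun _ => (1:ℝ)) • h s := by
      unfold xpHat
      rw [← intervalIntegral.integral_smul_const, ← intervalIntegral.integral_sub]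
      · congr 1; ext t; simp [smul_sub]
      · exact ContinuousOn.intervalIntegrable_of_Icc hsb.le (xp_cs μ s hh)
      · apply Continuous.intervalIntegrable; fun_prop
    rw [e1, xpHat_one _ _ _ hμ.ne', smul_sub, smul_smul, mul_div_cancel₀ _ hμ.ne']
    abel
  have hmain : Tendsto (fun μ : ℝ => μ • xpHat μ s b (fun t => h t - h s)) atTop (𝓝 0) := by
    rw [Metric.tendsto_atTop]
    intro ε hε
    obtain ⟨δ, hδ, hδ'⟩ := Metric.continuousOn_iff.1 hh s ⟨le_rfl, hsb.le⟩ (ε/3) (by linarith)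
    set c := min (s + δ/2) b with hc
    have hsc : s < c := lt_min (by linarith) hsb
    have hcb : c ≤ b := min_le_right _ _
    have hlim : Tendsto (fun μ : ℝ => 2 * B * Real.exp (-(μ * (c - s)))) atTop (𝓝 (2*B*0)) :=
      (xp_tendsto_exp (c - s) (by linarith)).const_mul _
    rw [mul_zero, Metric.tendsto_atTop] at hlim
    obtain ⟨M, hM⟩ := hlim (ε/3) (by linarith)
    refine ⟨max M 1, fun μ hμ => ?_⟩
    have hμ0 : 0 < μ := by linarith [le_max_right M 1]
    have hM' := hM μ ((le_max_left _ _).trans hμ)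
    have hint : ∀ u v, s ≤ u → u ≤ v → v ≤ b → IntervalIntegrable
        (fun t => Real.exp (-(μ * (t - s))) • (h t - h s)) volume u v := by
      intro u v hu huv hv
      apply ContinuousOn.intervalIntegrable_of_Icc huv
      exact ContinuousOn.smul (by fun_prop)
        ((hh.mono (Icc_subset_Icc hu hv)).sub continuousOn_const)
    have hsplit : xpHat μ s b (fun t => h t - h s) = xpHat μ s c (fun t => h t - h s)
        + Real.exp (-(μ * (c - s))) • xpHat μ c b (fun t => h t - h s) := by
      unfold xpHat
      rw [← intervalIntegral.integral_smul,
        ← intervalIntegral.integral_add_adjacent_intervals (hint s c le_rfl hsc.le hcb)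
          (hint c b hsc.le hcb le_rfl)]
      congr 2; ext t
      rw [smul_smul, ← Real.exp_add]; congr 2; ring
    have n1 : ‖xpHat μ s c (fun t => h t - h s)‖ ≤ (ε/3) / μ := by
      apply xpHat_norm_le μ s c hμ0 hsc.le _ _ (by linarith)
      intro t ht
      rw [← dist_eq_norm]
      refine (hδ' t ⟨ht.1, ht.2.trans hcb⟩ ?_).le
      rw [Real.dist_eq, abs_of_nonneg (by linarith [ht.1])]
      have := ht.2.trans (min_le_left (s+δ/2) b)
      linarith
    have n2 : ‖xpHat μ c b (fun t => h t - h s)‖ ≤ (2*B) / μ := by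
      apply xpHat_norm_le μ c b hμ0 hcb _ _ (by linarith)
      intro t ht
      refine (norm_sub_le _ _).trans ?_
      linarith [hB t ⟨hsc.le.trans ht.1, ht.2⟩, hB s ⟨le_rfl, hsb.le⟩]
    rw [dist_zero_right, hsplit, norm_smul, Real.norm_eq_abs, abs_of_pos hμ0]
    rw [Real.dist_eq, sub_zero, abs_of_nonneg (by positivity)] at hM'
    have n3 : ‖xpHat μ s c (fun t => h t - h s)
        + Real.exp (-(μ * (c - s))) • xpHat μ c b (fun t => h t - h s)‖
        ≤ (ε/3)/μ + Real.exp (-(μ * (c - s))) * ((2*B)/μ) := by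
      refine (norm_add_le _ _).trans (add_le_add n1 ?_)
      rw [norm_smul, Real.norm_eq_abs, abs_of_pos (Real.exp_pos _)]
      exact mul_le_mul_of_nonneg_left n2 (Real.exp_nonneg _)
    calc _ ≤ μ * ((ε/3)/μ + Real.exp (-(μ * (c - s))) * ((2*B)/μ)) :=
          mul_le_mul_of_nonneg_left n3 hμ0.le
      _ = ε/3 + 2 * B * Real.exp (-(μ * (c - s))) := by field_simp
      _ < ε := by linarith
  have hl2 : Tendsto (fun μ : ℝ => (1 - Real.exp (-(μ * (b - s)))) • h s) atTop
      (𝓝 ((1 - 0 : ℝ) • h s)) :=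
    ((tendsto_const_nhds.sub (xp_tendsto_exp (b - s) (by linarith)))).smul_const _
  have := hmain.add hl2
  simp only [sub_zero, one_smul, zero_add] at this
  refine this.congr' ?_
  filter_upwards [eventually_gt_atTop 0] with μ hμ using (hdiff μ hμ).symm

/-- maximum-type argument -/
theorem xp_max_real (a b : ℝ) (g : ℝ → ℝ) (hg : ContinuousOn g (Icc a b))
    (hl : ∀ s ∈ Ico a b, Tendsto (fun μ : ℝ => μ • xpLap μ s b g) atTop (𝓝 0)) :
    ∀ s ∈ Icc a b, g s ≤ g b := by
  intro s0 hs0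
  by_contra hcon
  push Not at hcon
  have hlt : s0 < b := lt_of_le_of_ne hs0.2 (by rintro rfl; exact lt_irrefl _ hcon)
  set ε := (g s0 - g b) / (2 * (b - s0)) with hε
  have hεpos : 0 < ε := div_pos (by linarith) (by linarith)
  have hε2 : ε * (b - s0) = (g s0 - g b)/2 := by
    rw [hε]; field_simp [(sub_pos.2 hlt).ne']
  have hcont : ContinuousOn (fun t => g t + ε * t) (Icc s0 b) :=
    (hg.mono (Icc_subset_Icc hs0.1 le_rfl)).add (by fun_prop)
  obtain ⟨s, hs, hmax⟩ := isCompact_Icc.exists_isMaxOn ⟨s0, le_rfl, hs0.2⟩ hcont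
  have hsb : s < b := by
    refine lt_of_le_of_ne hs.2 ?_
    rintro rfl
    have : g s0 + ε * s0 ≤ g s + ε * s := hmax ⟨le_rfl, hs0.2⟩
    nlinarith
  have hlim := hl s ⟨hs0.1.trans hs.1, hsb⟩
  have hgs : ContinuousOn g (Icc s b) := hg.mono (Icc_subset_Icc (hs0.1.trans hs.1) le_rfl)
  have hle : ∀ t ∈ Icc s b, g t - g s ≤ -ε * (t - s) := by
    intro t ht
    have : g t + ε * t ≤ g s + ε * s := hmax ⟨hs.1.trans ht.1, ht.2⟩
    linarith
  have hbd : ∀ μ : ℝ, 0 < μ → μ • xpLap μ s b g ≤ -ε * (1 - Real.exp (-(μ * (b - s)))) := by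
    intro μ hμ
    have e1 : xpLap μ s b (fun t => -ε * t) = xpHat μ s b (fun _ => -ε) := by
      apply xpLap_eq_hat μ s b hsb.le _ _ (by fun_prop) (by fun_prop)
      intro t _
      simpa using (hasDerivAt_id t).const_mul (-ε)
    have e2 : xpHat μ s b (fun _ => -ε) = (1 - Real.exp (-(μ * (b - s)))) / μ * (-ε) := by
      rw [← xpHat_one _ _ _ hμ.ne']
      unfold xpHat
      rw [← intervalIntegral.integral_mul_const]; simp
    have e3 : xpLap μ s b g ≤ xpLap μ s b (fun t => -ε * t) := by
      unfold xpLap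
      apply add_le_add
      · apply mul_le_mul_of_nonneg_left _ hμ.le
        apply xpHat_mono μ s b hsb.le _ _ (hgs.sub continuousOn_const) (by fun_prop)
        intro t ht; have := hle t ht; simp only [Pi.sub_apply]; linarith
      · apply mul_le_mul_of_nonneg_left _ (Real.exp_nonneg _)
        have := hle b ⟨hsb.le, le_rfl⟩; linarith
    rw [e1, e2] at e3
    calc μ • xpLap μ s b g ≤ μ * ((1 - Real.exp (-(μ * (b - s)))) / μ * (-ε)) :=
          mul_le_mul_of_nonneg_left e3 hμ.le
      _ = _ := by field_simp
  have hlim2 : Tendsto (fun μ : ℝ => -ε * (1 - Real.exp (-(μ * (b - s))))) atTop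
      (𝓝 (-ε * (1 - 0))) :=
    (tendsto_const_nhds.sub (xp_tendsto_exp (b - s) (by linarith))).const_mul _
  have := le_of_tendsto_of_tendsto hlim hlim2
    (by filter_upwards [eventually_gt_atTop 0] with μ hμ using hbd μ hμ)
  linarith

theorem xpLap_clm (L : ℂ →L[ℝ] ℝ) (μ s b : ℝ) (hsb : s ≤ b) (g : ℝ → ℂ)
    (hg : ContinuousOn g (Icc s b)) :
    xpLap μ s b (fun t => L (g t)) = L (xpLap μ s b g) := by
  unfold xpLap xpHat
  rw [map_add, map_smul, map_smul, map_sub]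
  rw [← ContinuousLinearMap.intervalIntegral_comp_comm]
  · simp only [map_smul, map_sub]
  · exact ContinuousOn.intervalIntegrable_of_Icc hsb
      (xp_cs μ s (hg.sub continuousOn_const))

theorem xp_max_complex (a b : ℝ) (g : ℝ → ℂ) (hg : ContinuousOn g (Icc a b))
    (hl : ∀ s ∈ Ico a b, Tendsto (fun μ : ℝ => μ • xpLap μ s b g) atTop (𝓝 0)) :
    ∀ s ∈ Icc a b, g s = g b := by
  have key : ∀ L : ℂ →L[ℝ] ℝ, ∀ s ∈ Icc a b, L (g s) ≤ L (g b) := by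
    intro L
    apply xp_max_real a b (fun t => L (g t)) (L.continuous.comp_continuousOn hg)
    intro s hs
    have h1 := (L.continuous.tendsto 0).comp (hl s hs)
    rw [map_zero] at h1
    refine h1.congr fun μ => ?_
    simp only [Function.comp]
    rw [xpLap_clm L μ s b hs.2.le g (hg.mono (Icc_subset_Icc hs.1 le_rfl)), map_smul]
  intro s hs
  apply Complex.ext
  · have h1 := key Complex.reCLM s hs
    have h2 := key (-Complex.reCLM) s hs
    simp at h1 h2; linarith
  · have h1 := key Complex.imCLM s hs
    have h2 := key (-Complex.imCLM) s hs
    simp at h1 h2; linarith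

theorem xp_ode_part (r : ℝ) (hr : 0 < r) (κ : ℂ) (hκ : κ.re = r) (c d B : ℝ)
    (H : ℝ → ℂ) (hH : Continuous H) (hB : ∀ x ∈ Icc c d, ‖H x‖ ≤ B) :
    ∃ V V1 : ℝ → ℂ, (∀ x, HasDerivAt V (V1 x) x) ∧ (∀ x, HasDerivAt V1 (κ^2 * V x + H x) x) ∧
      ∀ x ∈ Icc c d, ‖V x‖ ≤ B / r^2 := by
  have hκ0 : κ ≠ 0 := by rintro rfl; simp at hκ; linarith
  set A : ℝ → ℂ := fun x => ∫ y in c..x, Complex.exp (κ * y) * H y with hA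
  set D : ℝ → ℂ := fun x => ∫ y in d..x, Complex.exp (-κ * y) * H y with hD
  have cA : Continuous (fun y : ℝ => Complex.exp (κ * y) * H y) := by fun_prop
  have cD : Continuous (fun y : ℝ => Complex.exp (-κ * y) * H y) := by fun_prop
  have dA : ∀ x : ℝ, HasDerivAt A (Complex.exp (κ * x) * H x) x := fun x =>
    (cA.integral_hasStrictDerivAt c x).hasDerivAt
  have dD : ∀ x : ℝ, HasDerivAt D (Complex.exp (-κ * x) * H x) x := fun x =>
    (cD.integral_hasStrictDerivAt d x).hasDerivAt
  have de : ∀ (z : ℂ) (x : ℝ), HasDerivAt (fun x : ℝ => Complex.exp (z * x))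
      (Complex.exp (z * x) * z) x := by
    intro z x
    have h0 : HasDerivAt (fun x : ℝ => z * (x:ℂ)) (z * 1) x :=
      (Complex.ofRealCLM.hasDerivAt (x := x)).const_mul z
    simpa using h0.cexp
  have hmul : ∀ x : ℝ, Complex.exp (κ * x) * Complex.exp (-κ * x) = 1 := by
    intro x; rw [← Complex.exp_add]; simp
  refine ⟨fun x => -(1/(2*κ)) * (Complex.exp (-κ * x) * A x - Complex.exp (κ * x) * D x),
    fun x => (1/2) * (Complex.exp (-κ * x) * A x + Complex.exp (κ * x) * D x), ?_, ?_, ?_⟩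
  · intro x
    refine HasDerivAt.congr_deriv
      ((((de (-κ) x).mul (dA x)).sub ((de κ x).mul (dD x))).const_mul (-(1/(2*κ)))) ?_
    field_simp
    linear_combination (0:ℂ) * hmul x
  · intro x
    refine HasDerivAt.congr_deriv
      ((((de (-κ) x).mul (dA x)).add ((de κ x).mul (dD x))).const_mul (1/2)) ?_
    have hm := hmul x
    rw [neg_mul] at hm
    simp only [neg_mul]
    field_simp
    linear_combination (2 * H x) * hm
  · intro x hx
    have hB0 : 0 ≤ B := (norm_nonneg _).trans (hB x hx)
    have dre : ∀ z x : ℝ, z ≠ 0 → HasDerivAt (fun x : ℝ => Real.exp (z * x) * B / z)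
        (Real.exp (z * x) * B) x := by
      intro z x hz
      have h0 : HasDerivAt (fun x : ℝ => z * x) (z * 1) x := (hasDerivAt_id x).const_mul z
      refine HasDerivAt.congr_deriv ((h0.exp.mul_const B).div_const z) ?_
      field_simp
    have nA : ‖A x‖ ≤ Real.exp (r * x) * (B / r) := by
      have : ‖A x‖ ≤ ∫ y in c..x, Real.exp (r * y) * B := by
        apply intervalIntegral.norm_integral_le_of_norm_le hx.1
        · refine Eventually.of_forall fun y hy => ?_
          rw [norm_mul, Complex.norm_exp]
          have : (κ * y).re = r * y := by simp [hκ]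
          rw [this]
          exact mul_le_mul_of_nonneg_left (hB y ⟨hy.1.le, hy.2.trans hx.2⟩) (Real.exp_nonneg _)
        · apply Continuous.intervalIntegrable; fun_prop
      rw [intervalIntegral.integral_eq_sub_of_hasDerivAt (fun y _ => dre r y hr.ne')
        (by apply Continuous.intervalIntegrable; fun_prop)] at this
      refine this.trans ?_
      have : 0 ≤ Real.exp (r * c) * B / r := by positivity
      simp only [mul_div_assoc] at *
      linarith
    have nD : ‖D x‖ ≤ Real.exp (-r * x) * (B / r) := by
      have : ‖D x‖ ≤ ∫ y in x..d, Real.exp (-r * y) * B := by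
        rw [hD]; simp only
        rw [intervalIntegral.integral_symm, norm_neg]
        apply intervalIntegral.norm_integral_le_of_norm_le hx.2
        · refine Eventually.of_forall fun y hy => ?_
          rw [norm_mul, Complex.norm_exp]
          have : (-κ * y).re = -r * y := by simp [hκ]
          rw [this]
          exact mul_le_mul_of_nonneg_left (hB y ⟨hx.1.trans hy.1.le, hy.2⟩) (Real.exp_nonneg _)
        · apply Continuous.intervalIntegrable; fun_prop
      rw [intervalIntegral.integral_eq_sub_of_hasDerivAt (fun y _ => dre (-r) y (by linarith))
        (by apply Continuous.intervalIntegrable; fun_prop)] at this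
      refine this.trans ?_
      have : 0 ≤ Real.exp (-r * d) * B / r := by positivity
      simp only [div_neg, mul_div_assoc] at *
      linarith
    have hκr : r ≤ ‖κ‖ := hκ ▸ Complex.re_le_norm κ
    have n1 : ‖Complex.exp (-κ * x) * A x - Complex.exp (κ * x) * D x‖ ≤ 2 * (B / r) := by
      refine (norm_sub_le _ _).trans ?_
      rw [norm_mul, norm_mul, Complex.norm_exp, Complex.norm_exp]
      have e1 : (-κ * x).re = -r * x := by simp [hκ]
      have e2 : (κ * x).re = r * x := by simp [hκ]
      rw [e1, e2]
      have e3 : Real.exp (-r * x) * Real.exp (r * x) = 1 := by rw [← Real.exp_add]; simp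
      have u1 := mul_le_mul_of_nonneg_left nA (Real.exp_nonneg (-r * x))
      have u2 := mul_le_mul_of_nonneg_left nD (Real.exp_nonneg (r * x))
      rw [← mul_assoc, e3] at u1
      have e4 : Real.exp (r * x) * Real.exp (-r * x) = 1 := by rw [mul_comm, e3]
      rw [← mul_assoc, e4] at u2
      linarith
    have n2 : ‖-(1/(2*κ))‖ ≤ 1/(2*r) := by
      rw [norm_neg, norm_div, norm_mul]; simp
      gcongr
    rw [norm_mul]
    calc _ ≤ 1/(2*r) * (2 * (B/r)) := mul_le_mul n2 n1 (norm_nonneg _) (by positivity)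
      _ = _ := by field_simp

theorem xp_ode (μ : ℝ) (hμ : 0 < μ) (c d B N : ℝ) (hcd : c < d)
    (H Y Y1 : ℝ → ℂ) (hH : Continuous H) (hB : ∀ x ∈ Icc c d, ‖H x‖ ≤ B)
    (hY : ContinuousOn Y (Icc c d))
    (hY0 : ∀ x ∈ Ioo c d, HasDerivAt Y (Y1 x) x)
    (hY1 : ∀ x ∈ Ioo c d, HasDerivAt Y1 (-(2 * Complex.I * μ) * Y x + H x) x)
    (hc : ‖Y c‖ ≤ N) (hd : ‖Y d‖ ≤ N) : ∀ x ∈ Icc c d, ‖Y x‖ ≤ N + 2 * B / μ := by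
  have hr : 0 < √μ := Real.sqrt_pos.2 hμ
  set κ : ℂ := (√μ : ℝ) * (1 - Complex.I) with hκ
  have hκ2 : κ^2 = -(2 * Complex.I * μ) := by
    rw [hκ, mul_pow]
    have : ((√μ : ℝ) : ℂ)^2 = μ := by rw [← Complex.ofReal_pow, Real.sq_sqrt hμ.le]
    rw [this]
    linear_combination (μ:ℂ) * Complex.I_sq
  obtain ⟨V, V1, hV, hV1, hVB⟩ := xp_ode_part (√μ) hr κ (by simp [hκ]) c d B H hH hB
  rw [Real.sq_sqrt hμ.le] at hVB
  rw [hκ2] at hV1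
  have cV : Continuous V := continuous_iff_continuousAt.2 fun x => (hV x).continuousAt
  set Z : ℝ → ℂ := fun x => Y x - V x with hZ
  set Z1 : ℝ → ℂ := fun x => Y1 x - V1 x with hZ1
  have dZ : ∀ x ∈ Ioo c d, HasDerivAt Z (Z1 x) x := fun x hx => (hY0 x hx).sub (hV x)
  have dZ1 : ∀ x ∈ Ioo c d, HasDerivAt Z1 (-(2 * Complex.I * μ) * Z x) x := fun x hx => by
    refine HasDerivAt.congr_deriv ((hY1 x hx).sub (hV1 x)) ?_
    simp only [hZ]; ring
  set P : ℝ → ℝ := fun x => (Z x).re^2 + (Z x).im^2 with hP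
  have cZ : ContinuousOn Z (Icc c d) := hY.sub cV.continuousOn
  have hre : ∀ (f : ℝ → ℂ) (f' : ℂ) (x : ℝ), HasDerivAt f f' x →
      HasDerivAt (fun y => (f y).re) f'.re x := fun f f' x h =>
    (Complex.reCLM.hasFDerivAt.comp_hasDerivAt x h)
  have him : ∀ (f : ℝ → ℂ) (f' : ℂ) (x : ℝ), HasDerivAt f f' x →
      HasDerivAt (fun y => (f y).im) f'.im x := fun f f' x h =>
    (Complex.imCLM.hasFDerivAt.comp_hasDerivAt x h)
  set P1 : ℝ → ℝ := fun x => 2 * ((Z x).re * (Z1 x).re + (Z x).im * (Z1 x).im) with hP1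
  have dP : ∀ x ∈ Ioo c d, HasDerivAt P (P1 x) x := by
    intro x hx
    refine HasDerivAt.congr_deriv
      (((hre _ _ _ (dZ x hx)).pow 2).add ((him _ _ _ (dZ x hx)).pow 2)) ?_
    simp only [hP1]; ring
  have dP1 : ∀ x ∈ Ioo c d, HasDerivAt P1 (2 * ((Z1 x).re^2 + (Z1 x).im^2)) x := by
    intro x hx
    refine HasDerivAt.congr_deriv
      ((((hre _ _ _ (dZ x hx)).mul (hre _ _ _ (dZ1 x hx))).add
        ((him _ _ _ (dZ x hx)).mul (him _ _ _ (dZ1 x hx)))).const_mul 2) ?_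
    simp; ring
  have cP : ContinuousOn P (Icc c d) :=
    ((Complex.continuous_re.comp_continuousOn cZ).pow 2).add
      ((Complex.continuous_im.comp_continuousOn cZ).pow 2)
  have conv : ConvexOn ℝ (Icc c d) P := by
    apply convexOn_of_hasDerivWithinAt2_nonneg (convex_Icc c d) cP (f' := P1)
      (f'' := fun x => 2 * ((Z1 x).re^2 + (Z1 x).im^2))
    · rw [interior_Icc]; exact fun x hx => (dP x hx).hasDerivWithinAt
    · rw [interior_Icc]; exact fun x hx => (dP1 x hx).hasDerivWithinAt
    · intro x _; positivity
  have hPn : ∀ x, P x = ‖Z x‖^2 := by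
    intro x; rw [← Complex.normSq_eq_norm_sq, Complex.normSq_apply]; simp only [hP]; ring
  have hZb : ∀ x ∈ Icc c d, ‖Y x‖ ≤ N → ‖Z x‖ ≤ N + B/μ := fun x hx h =>
    (norm_sub_le _ _).trans (add_le_add h (hVB x hx))
  have z1 := hZb c ⟨le_rfl, hcd.le⟩ hc
  have z2 := hZb d ⟨hcd.le, le_rfl⟩ hd
  intro x hx
  have hmax := conv.le_max_of_mem_Icc ⟨le_rfl, hcd.le⟩ ⟨hcd.le, le_rfl⟩ hx
  have hnn : 0 ≤ N + B/μ := (norm_nonneg _).trans z1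
  have : ‖Z x‖^2 ≤ (N + B/μ)^2 := by
    rw [← hPn]
    refine hmax.trans (max_le ?_ ?_)
    · rw [hPn]; gcongr
    · rw [hPn]; gcongr
  have hzx : ‖Z x‖ ≤ N + B/μ := le_of_sq_le_sq this hnn
  have : Y x = Z x + V x := by simp [hZ]
  rw [this]
  refine (norm_add_le _ _).trans ?_
  have := hVB x hx
  have e : 2 * B / μ = B/μ + B/μ := by ring
  linarith


theorem xpHat_cont (μ s b : ℝ) (G : ℝ → ℝ → ℂ) (hG : Continuous (fun z : ℝ × ℝ => G z.1 z.2)) :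
    Continuous (fun ξ => xpHat μ s b (fun t => G t ξ)) := by
  unfold xpHat
  apply intervalIntegral.continuous_parametric_intervalIntegral_of_continuous'
  have : Continuous (fun z : ℝ × ℝ => G z.2 z.1) := hG.comp continuous_swap
  have h2 : Continuous (fun z : ℝ × ℝ => Real.exp (-(μ * (z.2 - s))) • G z.2 z.1) := by fun_prop
  exact h2

theorem xp_col (G : ℝ → ℝ → ℂ) (hG : Continuous (fun z : ℝ × ℝ => G z.1 z.2)) (ξ : ℝ) :
    Continuous (fun t => G t ξ) := hG.comp (by fun_prop : Continuous fun t : ℝ => (t, ξ))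

theorem xp_row (G : ℝ → ℝ → ℂ) (hG : Continuous (fun z : ℝ × ℝ => G z.1 z.2)) (t : ℝ) :
    Continuous (fun ξ => G t ξ) := hG.comp (by fun_prop : Continuous fun ξ : ℝ => (t, ξ))

theorem xp_rowint (G : ℝ → ℝ → ℂ) (hG : Continuous (fun z : ℝ × ℝ => G z.1 z.2)) (u v : ℝ) :
    Continuous (fun t => ∫ ξ in u..v, G t ξ) :=
  intervalIntegral.continuous_parametric_intervalIntegral_of_continuous' hG u v

theorem xp_timeint (a : ℝ) (G : ℝ → ℝ → ℂ) (hG : Continuous (fun z : ℝ × ℝ => G z.1 z.2)) :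
    Continuous (fun z : ℝ × ℝ => ∫ τ in a..z.1, G τ z.2) := by
  have : Continuous (fun w : (ℝ × ℝ) × ℝ => G w.2 w.1.2) :=
    hG.comp (by fun_prop : Continuous fun w : (ℝ × ℝ) × ℝ => (w.2, w.1.2))
  exact intervalIntegral.continuous_parametric_intervalIntegral_of_continuous
    (f := fun (z : ℝ × ℝ) τ => G τ z.2) (s := fun z : ℝ × ℝ => z.1) this continuous_fst

theorem xpHat_add (μ s b : ℝ) (g h : ℝ → ℂ) (hg : Continuous g) (hh : Continuous h) :
    xpHat μ s b (fun t => g t + h t) = xpHat μ s b g + xpHat μ s b h := by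
  unfold xpHat
  rw [← intervalIntegral.integral_add]
  · simp only [smul_add]
  all_goals apply Continuous.intervalIntegrable; fun_prop

theorem xpHat_mul (μ s b : ℝ) (c : ℂ) (g : ℝ → ℂ) :
    xpHat μ s b (fun t => c * g t) = c * xpHat μ s b g := by
  unfold xpHat
  rw [← intervalIntegral.integral_const_mul]
  simp only [mul_smul_comm]

theorem xpLap_add (μ s b : ℝ) (g h : ℝ → ℂ) (hg : Continuous g) (hh : Continuous h) :
    xpLap μ s b (fun t => g t + h t) = xpLap μ s b g + xpLap μ s b h := by
  unfold xpLap
  have : (fun t => g t + h t - (g s + h s)) = fun t => (g t - g s) + (h t - h s) := by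
    funext t; ring
  rw [this, xpHat_add _ _ _ _ _ (by fun_prop) (by fun_prop)]
  simp only [Complex.real_smul]; ring

theorem xpLap_mul (μ s b : ℝ) (c : ℂ) (g : ℝ → ℂ) :
    xpLap μ s b (fun t => c * g t) = c * xpLap μ s b g := by
  unfold xpLap
  have : (fun t => c * g t - c * g s) = fun t => c * (g t - g s) := by
    funext t; ring
  rw [this, xpHat_mul]
  simp only [Complex.real_smul]; ring

theorem xpLap_sub_const (μ s b : ℝ) (g : ℝ → ℂ) (c : ℂ) :
    xpLap μ s b (fun t => g t - c) = xpLap μ s b g := by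
  unfold xpLap
  simp

theorem xpHat_int (μ s b u v : ℝ) (G : ℝ → ℝ → ℂ)
    (hG : Continuous (fun z : ℝ × ℝ => G z.1 z.2)) :
    xpHat μ s b (fun t => ∫ ξ in u..v, G t ξ) = ∫ ξ in u..v, xpHat μ s b (fun t => G t ξ) := by
  unfold xpHat
  simp only [← intervalIntegral.integral_smul]
  apply MeasureTheory.intervalIntegral_intervalIntegral_swap
  have : Continuous (fun z : ℝ × ℝ => Real.exp (-(μ * (z.1 - s))) • G z.1 z.2) := by fun_prop
  exact (this.continuousOn.integrableOn_compact (isCompact_uIcc.prod isCompact_uIcc)).mono_set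
    (prod_mono uIoc_subset_uIcc uIoc_subset_uIcc)

theorem xpLap_expand (μ s b : ℝ) (hμ : μ ≠ 0) (g : ℝ → ℂ) (hg : Continuous g) :
    xpLap μ s b g = μ * xpHat μ s b g - g s + Real.exp (-(μ * (b - s))) * g b := by
  have e : (fun t => g t - g s) = fun t => g t + (-g s) * (1:ℂ) := by funext t; ring
  have h1 : xpHat μ s b (fun _ => (1:ℂ)) = ((1 - Real.exp (-(μ * (b - s)))) / μ : ℝ) := by
    rw [← xpHat_one μ s b hμ]
    unfold xpHat
    rw [← intervalIntegral.integral_ofReal]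
    simp
  unfold xpLap
  rw [e, xpHat_add _ _ _ _ _ hg (by fun_prop), xpHat_mul, h1]
  have : (μ:ℂ) ≠ 0 := by exact_mod_cast hμ
  simp only [Complex.real_smul]
  push_cast
  field_simp
  ring

theorem xpLap_cont (μ s b : ℝ) (G : ℝ → ℝ → ℂ) (hG : Continuous (fun z : ℝ × ℝ => G z.1 z.2)) :
    Continuous (fun ξ => xpLap μ s b (fun t => G t ξ)) := by
  unfold xpLap
  have h := xpHat_cont μ s b (fun t ξ => G t ξ - G s ξ) (by
    have := (xp_row G hG s).comp (continuous_snd (X := ℝ) (Y := ℝ))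
    exact hG.sub this)
  have h1 := xp_row G hG b
  have h2 := xp_row G hG s
  exact (h.const_smul μ).add ((h1.sub h2).const_smul _)

theorem xpLap_int (μ s b u v : ℝ) (G : ℝ → ℝ → ℂ)
    (hG : Continuous (fun z : ℝ × ℝ => G z.1 z.2)) :
    xpLap μ s b (fun t => ∫ ξ in u..v, G t ξ) = ∫ ξ in u..v, xpLap μ s b (fun t => G t ξ) := by
  have c1 : Continuous (fun z : ℝ × ℝ => G z.1 z.2 - G s z.2) :=
    hG.sub ((xp_row G hG s).comp (continuous_snd (X := ℝ) (Y := ℝ)))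
  have h := xpHat_int μ s b u v (fun t ξ => G t ξ - G s ξ) c1
  have h3 := xpHat_cont μ s b (fun t ξ => G t ξ - G s ξ) c1
  have h1 := xp_row G hG b
  have h2 := xp_row G hG s
  unfold xpLap
  rw [intervalIntegral.integral_add, intervalIntegral.integral_smul, ← h,
    intervalIntegral.integral_smul, intervalIntegral.integral_sub]
  · congr 3
    funext t
    rw [intervalIntegral.integral_sub]
    · exact (xp_row G hG t).intervalIntegrable _ _
    · exact h2.intervalIntegrable _ _
  · exact h1.intervalIntegrable _ _
  · exact h2.intervalIntegrable _ _
  · exact (h3.const_smul μ).intervalIntegrable _ _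
  · exact ((h1.sub h2).const_smul _).intervalIntegrable _ _

theorem xp_gap (S : Set ℝ) (hS : IsClosed S) (x y : ℝ) (hx : x ∈ S) (hy : y ∈ S)
    (ξ : ℝ) (hξ : ξ ∈ Icc x y) (hn : ξ ∉ S) :
    ∃ c ∈ S, ∃ d ∈ S, x ≤ c ∧ d ≤ y ∧ c < ξ ∧ ξ < d ∧ ∀ z ∈ Ioo c d, z ∉ S := by
  have k1 : IsCompact (S ∩ Icc x ξ) := isCompact_Icc.inter_left hS
  have k2 : IsCompact (S ∩ Icc ξ y) := isCompact_Icc.inter_left hS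
  obtain ⟨c, hc, hc'⟩ := k1.exists_isGreatest ⟨x, hx, le_rfl, hξ.1⟩
  obtain ⟨d, hd, hd'⟩ := k2.exists_isLeast ⟨y, hy, hξ.2, le_rfl⟩
  refine ⟨c, hc.1, d, hd.1, hc.2.1, hd.2.2, lt_of_le_of_ne hc.2.2 ?_, lt_of_le_of_ne hd.2.1 ?_, ?_⟩
  · rintro rfl; exact hn hc.1
  · rintro rfl; exact hn hd.1
  · intro z hz hzS
    rcases le_total z ξ with h | h
    · exact absurd (hc' ⟨hzS, hc.2.1.trans hz.1.le, h⟩) (not_le.2 hz.1)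
    · exact absurd (hd' ⟨hzS, h, hz.2.le.trans hd.2.2⟩) (not_le.2 hz.2)


structure XpSys (a b : ℝ) (p k C f q : ℝ → ℝ → ℂ) : Prop where
  hab : a < b
  cp : Continuous (fun z : ℝ × ℝ => p z.1 z.2)
  ck : Continuous (fun z : ℝ × ℝ => k z.1 z.2)
  cC : Continuous (fun z : ℝ × ℝ => C z.1 z.2)
  dt : ∀ t ∈ Ioo a b, ∀ x, HasDerivAt (fun s => p s x) (f t x) t
  cf : ∀ x, ContinuousOn (fun t => f t x) (Icc a b)
  dx : ∀ t x, HasDerivAt (p t) (k t x) x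
  dxx : ∀ t x, HasDerivAt (k t) (q t x) x
  cq : ∀ t, Continuous (q t)
  eq : ∀ t ∈ Icc a b, ∀ x, Complex.I * f t x + (1/2) * q t x = C t x

noncomputable def xpD (a : ℝ) (p k C : ℝ → ℝ → ℂ) (t x : ℝ) : ℂ :=
  Complex.I * (∫ ξ in (0:ℝ)..x, (p t ξ - p a ξ)) + (1/2) * (∫ τ in a..t, k τ x)
    - ∫ ξ in (0:ℝ)..x, ∫ τ in a..t, C τ ξ

section
variable {a b : ℝ} {p k C f q : ℝ → ℝ → ℂ}

theorem XpSys.cpa (S : XpSys a b p k C f q) : Continuous (fun z : ℝ × ℝ => p z.1 z.2 - p a z.2) :=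
  S.cp.sub ((xp_row p S.cp a).comp (continuous_snd (X := ℝ) (Y := ℝ)))

theorem XpSys.D_sub (S : XpSys a b p k C f q) (t x1 x2 : ℝ) :
    xpD a p k C t x2 - xpD a p k C t x1 =
      Complex.I * (∫ ξ in x1..x2, (p t ξ - p a ξ)) + ((1/2) * ((∫ τ in a..t, k τ x2) +
        (-1) * (∫ τ in a..t, k τ x1)) + (-1) * ∫ ξ in x1..x2, ∫ τ in a..t, C τ ξ) := by
  unfold xpD
  have c1 := xp_row (fun t ξ => p t ξ - p a ξ) S.cpa t
  have c2 := xp_row (fun t ξ => ∫ τ in a..t, C τ ξ) (xp_timeint a C S.cC) t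
  rw [← intervalIntegral.integral_interval_sub_left (c1.intervalIntegrable 0 x2)
    (c1.intervalIntegrable 0 x1), ← intervalIntegral.integral_interval_sub_left
    (c2.intervalIntegrable 0 x2) (c2.intervalIntegrable 0 x1)]
  ring

theorem XpSys.lap_time (G : ℝ → ℝ → ℂ) (hG : Continuous (fun z : ℝ × ℝ => G z.1 z.2))
    (μ s x : ℝ) (hs : s ≤ b) :
    xpLap μ s b (fun t => ∫ τ in a..t, G τ x) = xpHat μ s b (fun t => G t x) := by
  have c := xp_col G hG x
  have d : ∀ t, HasDerivAt (fun t => ∫ τ in a..t, G τ x) (G t x) t := fun t =>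
    (c.integral_hasStrictDerivAt a t).hasDerivAt
  exact xpLap_eq_hat μ s b hs _ _
    (fun t _ => (d t).continuousAt.continuousWithinAt) c.continuousOn (fun t _ => d t)

theorem XpSys.D_cont (S : XpSys a b p k C f q) (x1 x2 : ℝ) :
    Continuous (fun t => xpD a p k C t x2 - xpD a p k C t x1) := by
  simp only [S.D_sub]
  have h1 := xp_rowint (fun t ξ => p t ξ - p a ξ) S.cpa x1 x2
  have h2 := xp_rowint (fun t ξ => ∫ τ in a..t, C τ ξ) (xp_timeint a C S.cC) x1 x2
  have h3 := xp_col (fun t ξ => ∫ τ in a..t, k τ ξ) (xp_timeint a k S.ck)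
  have h4 := h3 x1
  have h5 := h3 x2
  fun_prop

/-- Transformed identity -/
theorem XpSys.D_lap (S : XpSys a b p k C f q) (μ s x1 x2 : ℝ) (hs : s ≤ b) :
    xpLap μ s b (fun t => xpD a p k C t x2 - xpD a p k C t x1) =
      Complex.I * (∫ ξ in x1..x2, xpLap μ s b (fun t => p t ξ)) +
      (1/2) * (xpHat μ s b (fun t => k t x2) - xpHat μ s b (fun t => k t x1))
      - ∫ ξ in x1..x2, xpHat μ s b (fun t => C t ξ) := by
  simp only [S.D_sub]
  have h1 := xp_rowint (fun t ξ => p t ξ - p a ξ) S.cpa x1 x2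
  have h2 := xp_rowint (fun t ξ => ∫ τ in a..t, C τ ξ) (xp_timeint a C S.cC) x1 x2
  have h3 := xp_col (fun t ξ => ∫ τ in a..t, k τ ξ) (xp_timeint a k S.ck)
  have h4 := h3 x1
  have h5 := h3 x2
  rw [xpLap_add _ _ _ _ _ (by fun_prop) (by fun_prop), xpLap_mul,
    xpLap_add _ _ _ _ _ (by fun_prop) (by fun_prop), xpLap_mul,
    xpLap_add _ _ _ _ _ (by fun_prop) (by fun_prop), xpLap_mul, xpLap_mul,
    xpLap_int μ s b x1 x2 (fun t ξ => p t ξ - p a ξ) S.cpa,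
    xpLap_int μ s b x1 x2 (fun t ξ => ∫ τ in a..t, C τ ξ) (xp_timeint a C S.cC),
    XpSys.lap_time k S.ck μ s x2 hs, XpSys.lap_time k S.ck μ s x1 hs]
  simp only [XpSys.lap_time C S.cC μ s _ hs, xpLap_sub_const]
  ring

theorem XpSys.Y_deriv (S : XpSys a b p k C f q) (μ s ξ : ℝ) :
    HasDerivAt (fun ξ => xpLap μ s b (fun t => p t ξ)) (xpLap μ s b (fun t => k t ξ)) ξ := by
  have e : (fun ξ => xpLap μ s b (fun t => p t ξ)) = fun ξ => xpLap μ s b (fun t => p t 0)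
      + ∫ η in (0:ℝ)..ξ, xpLap μ s b (fun t => k t η) := by
    funext ξ
    rw [← xpLap_int μ s b 0 ξ k S.ck, ← xpLap_add _ _ _ _ _ (xp_col p S.cp 0)
      (xp_rowint k S.ck 0 ξ)]
    congr 1
    funext t
    rw [intervalIntegral.integral_eq_sub_of_hasDerivAt (fun y _ => S.dx t y)
      ((xp_row k S.ck t).intervalIntegrable _ _)]
    ring
  rw [e]
  exact (((xpLap_cont μ s b k S.ck).integral_hasStrictDerivAt 0 ξ).hasDerivAt).const_add _

def xpO (a b : ℝ) (p k C : ℝ → ℝ → ℂ) : Set ℝ :=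
  {x | ∀ᶠ y in 𝓝 x, ∀ t ∈ Icc a b, xpD a p k C t y = xpD a p k C t x}

theorem xpO_open : IsOpen (xpO a b p k C) := by
  rw [isOpen_iff_eventually]
  intro x hx
  have hx' : ∀ᶠ y in 𝓝 x, ∀ t ∈ Icc a b, xpD a p k C t y = xpD a p k C t x := hx
  filter_upwards [hx'.eventually_nhds, hx'] with y hy hy2
  show ∀ᶠ z in 𝓝 y, ∀ t ∈ Icc a b, xpD a p k C t z = xpD a p k C t y
  filter_upwards [hy] with z hz t ht
  rw [hz t ht, hy2 t ht]

theorem xpLap_zero (μ s b : ℝ) (hsb : s ≤ b) (g : ℝ → ℂ) (hg : ∀ t ∈ Icc s b, g t = 0) :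
    xpLap μ s b g = 0 := by
  unfold xpLap xpHat
  have : ∫ t in s..b, Real.exp (-(μ * (t - s))) • (g t - g s) = ∫ t in s..b, (0:ℂ) := by
    apply intervalIntegral.integral_congr
    intro t ht
    rw [uIcc_of_le hsb] at ht
    simp [hg t ht, hg s ⟨le_rfl, hsb⟩]
  rw [this, hg s ⟨le_rfl, hsb⟩, hg b ⟨hsb, le_rfl⟩]
  simp

theorem XpSys.khat_deriv (S : XpSys a b p k C f q) (μ s ξ : ℝ) (hs : s ∈ Icc a b)
    (hξ : ξ ∈ xpO a b p k C) :
    HasDerivAt (fun ξ => xpHat μ s b (fun t => k t ξ))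
      (2 * (xpHat μ s b (fun t => C t ξ) - Complex.I * xpLap μ s b (fun t => p t ξ))) ξ := by
  have c1 := xpLap_cont μ s b p S.cp
  have c2 := xpHat_cont μ s b C S.cC
  have d : HasDerivAt (fun y => xpHat μ s b (fun t => k t ξ) + 2 *
      ∫ η in ξ..y, (xpHat μ s b (fun t => C t η) - Complex.I * xpLap μ s b (fun t => p t η)))
      (2 * (xpHat μ s b (fun t => C t ξ) - Complex.I * xpLap μ s b (fun t => p t ξ))) ξ := by
    have c3 := c2.sub (c1.const_mul Complex.I)
    exact (((c3.integral_hasStrictDerivAt ξ ξ).hasDerivAt).const_mul 2).const_add _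
  refine d.congr_of_eventuallyEq ?_
  have hξ' : ∀ᶠ y in 𝓝 ξ, ∀ t ∈ Icc a b, xpD a p k C t y = xpD a p k C t ξ := hξ
  filter_upwards [hξ'] with y hy
  have h0 := S.D_lap μ s ξ y hs.2
  rw [xpLap_zero μ s b hs.2 _ (fun t ht => by
    simp only [hy t ⟨hs.1.trans ht.1, ht.2⟩, sub_self])] at h0
  rw [intervalIntegral.integral_sub (c2.intervalIntegrable _ _)
    ((c1.const_mul Complex.I).intervalIntegrable _ _), intervalIntegral.integral_const_mul]
  linear_combination (-2) * h0

theorem XpSys.Y1_deriv (S : XpSys a b p k C f q) (μ s ξ : ℝ) (hμ : μ ≠ 0) (hs : s ∈ Icc a b)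
    (hξ : ξ ∈ xpO a b p k C) :
    HasDerivAt (fun ξ => xpLap μ s b (fun t => k t ξ))
      (-(2 * Complex.I * μ) * xpLap μ s b (fun t => p t ξ) + (2 * (μ * xpHat μ s b (fun t => C t ξ))
        - q s ξ + Real.exp (-(μ * (b - s))) * q b ξ)) ξ := by
  have e : (fun ξ => xpLap μ s b (fun t => k t ξ)) = fun ξ => μ * xpHat μ s b (fun t => k t ξ)
      - k s ξ + Real.exp (-(μ * (b - s))) * k b ξ := by
    funext ξ
    exact xpLap_expand μ s b hμ _ (xp_col k S.ck ξ)
  rw [e]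
  refine HasDerivAt.congr_deriv ((((S.khat_deriv μ s ξ hs hξ).const_mul (μ:ℂ)).sub
    (S.dxx s ξ)).add ((S.dxx b ξ).const_mul _)) ?_
  ring
end


section
variable {a b : ℝ} {p k C f q : ℝ → ℝ → ℂ}

def xpA (a b : ℝ) (p : ℝ → ℝ → ℂ) (N : ℕ) : Set ℝ :=
  {x | ∀ t ∈ Icc a b, ∀ t' ∈ Icc a b, ‖p t x - p t' x‖ ≤ N * |t - t'|}

theorem XpSys.A_closed (S : XpSys a b p k C f q) (N : ℕ) : IsClosed (xpA a b p N) := by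
  have : xpA a b p N = ⋂ t ∈ Icc a b, ⋂ t' ∈ Icc a b, {x | ‖p t x - p t' x‖ ≤ N * |t - t'|} := by
    ext x; simp only [xpA, mem_ofPred_eq, mem_iInter]
  rw [this]
  refine isClosed_biInter fun t _ => isClosed_biInter fun t' _ => ?_
  exact isClosed_le ((xp_row p S.cp t).sub (xp_row p S.cp t')).norm continuous_const

theorem XpSys.col_exists (S : XpSys a b p k C f q) (x : ℝ) :
    ∃ N : ℕ, ∀ t ∈ Icc a b, ‖f t x‖ ≤ N := by
  obtain ⟨B, hB⟩ := isCompact_Icc.exists_bound_of_continuousOn (S.cf x)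
  obtain ⟨N, hN⟩ := exists_nat_ge B
  exact ⟨N, fun t ht => (hB t ht).trans hN⟩

theorem XpSys.A_mem (S : XpSys a b p k C f q) (x : ℝ) (N : ℕ)
    (h : ∀ t ∈ Icc a b, ‖f t x‖ ≤ N) : x ∈ xpA a b p N := by
  have key : ∀ t ∈ Icc a b, ∀ t' ∈ Icc a b, t ≤ t' → ‖p t' x - p t x‖ ≤ N * (t' - t) := by
    intro t ht t' ht' htt
    have := intervalIntegral.integral_eq_sub_of_hasDerivAt_of_le htt
      (xp_col p S.cp x).continuousOn (f' := fun τ => f τ x)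
      (fun τ hτ => S.dt τ ⟨ht.1.trans_lt hτ.1, hτ.2.trans_le ht'.2⟩ x)
      (ContinuousOn.intervalIntegrable_of_Icc htt ((S.cf x).mono (Icc_subset_Icc ht.1 ht'.2)))
    rw [← this]
    have h2 := intervalIntegral.norm_integral_le_of_norm_le_const (a := t) (b := t') (C := N)
      (f := fun τ => f τ x) (fun τ hτ => by
        rw [uIoc_of_le htt] at hτ
        exact h τ ⟨ht.1.trans hτ.1.le, hτ.2.trans ht'.2⟩)
    rwa [abs_of_nonneg (by linarith)] at h2
  intro t ht t' ht'
  rcases le_total t t' with h1 | h1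
  · rw [norm_sub_rev, abs_sub_comm, abs_of_nonneg (by linarith)]
    exact key t ht t' ht' h1
  · rw [abs_of_nonneg (by linarith)]
    exact key t' ht' t ht h1

theorem XpSys.A_bound (S : XpSys a b p k C f q) (x : ℝ) (N : ℕ) (h : x ∈ xpA a b p N) :
    ∀ t ∈ Icc a b, ‖f t x‖ ≤ N := by
  have key : ∀ t ∈ Ioo a b, ‖f t x‖ ≤ N := by
    intro t ht
    apply (S.dt t ht x).le_of_lip' (Nat.cast_nonneg N)
    filter_upwards [Icc_mem_nhds ht.1 ht.2] with t' ht'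
    exact h t' ht' t ⟨ht.1.le, ht.2.le⟩
  intro t ht
  rw [← closure_Ioo S.hab.ne] at ht
  refine le_on_closure (f := fun t => ‖f t x‖) (g := fun _ => (N:ℝ)) key ?_ ?_ ht
  · rw [closure_Ioo S.hab.ne]; exact (S.cf x).norm
  · exact continuousOn_const

theorem XpSys.Y_eq (S : XpSys a b p k C f q) (μ s x : ℝ) (hs : s ∈ Icc a b) :
    xpLap μ s b (fun t => p t x) = xpHat μ s b (fun t => f t x) :=
  xpLap_eq_hat μ s b hs.2 _ _ (xp_col p S.cp x).continuousOn
    ((S.cf x).mono (Icc_subset_Icc hs.1 le_rfl))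
    (fun t ht => S.dt t ⟨hs.1.trans_lt ht.1, ht.2⟩ x)

theorem XpSys.Y_bound (S : XpSys a b p k C f q) (μ s x : ℝ) (hs : s ∈ Icc a b) (hμ : 0 < μ)
    (N : ℝ) (hN : ∀ t ∈ Icc a b, ‖f t x‖ ≤ N) :
    ‖xpLap μ s b (fun t => p t x)‖ ≤ N / μ := by
  rw [S.Y_eq μ s x hs]
  exact xpHat_norm_le μ s b hμ hs.2 _ N ((norm_nonneg _).trans (hN s hs))
    (fun t ht => hN t ⟨hs.1.trans ht.1, ht.2⟩)

theorem XpSys.U_bound (S : XpSys a b p k C f q) (s x y : ℝ) (hs : s ∈ Icc a b) (hxy : x < y)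
    (N : ℝ) (hN : ∀ ξ ∈ Icc x y, ξ ∉ xpO a b p k C → ∀ t ∈ Icc a b, ‖f t ξ‖ ≤ N) :
    ∃ M, ∀ μ : ℝ, 0 < μ → ∀ ξ ∈ Icc x y, ‖μ • xpLap μ s b (fun t => p t ξ)‖ ≤ M := by
  obtain ⟨N1, hN1⟩ := S.col_exists x
  obtain ⟨N2, hN2⟩ := S.col_exists y
  set N' : ℝ := max N (max N1 N2) with hN'
  set K : Set ℝ := ((xpO a b p k C)ᶜ ∩ Icc x y) ∪ {x, y} with hK
  have Kc : IsClosed K := (xpO_open.isClosed_compl.inter isClosed_Icc).union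
    (Set.toFinite _).isClosed
  have hKb : ∀ ξ ∈ K, ∀ t ∈ Icc a b, ‖f t ξ‖ ≤ N' := by
    intro ξ hξ t ht
    rcases hξ with h | h | h
    · exact (hN ξ h.2 h.1 t ht).trans (le_max_left _ _)
    · rw [h]; exact (hN1 t ht).trans ((le_max_left _ _).trans (le_max_right _ _))
    · rw [h]; exact (hN2 t ht).trans ((le_max_right _ _).trans (le_max_right _ _))
  obtain ⟨BC, hBC⟩ := (isCompact_Icc.prod isCompact_Icc : IsCompact (Icc a b ×ˢ Icc x y)).exists_bound_of_continuousOn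
    S.cC.continuousOn
  obtain ⟨Bs, hBs⟩ := (isCompact_Icc : IsCompact (Icc x y)).exists_bound_of_continuousOn
    (S.cq s).continuousOn
  obtain ⟨Bb, hBb⟩ := (isCompact_Icc : IsCompact (Icc x y)).exists_bound_of_continuousOn
    (S.cq b).continuousOn
  have hBC0 : 0 ≤ BC := (norm_nonneg _).trans (hBC (s, x) ⟨hs, le_rfl, hxy.le⟩)
  set B : ℝ := 2 * BC + Bs + Bb with hB
  have hB0 : 0 ≤ B := by
    have h1 := (norm_nonneg _).trans (hBs x ⟨le_rfl, hxy.le⟩)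
    have h2 := (norm_nonneg _).trans (hBb x ⟨le_rfl, hxy.le⟩)
    positivity
  refine ⟨N' + 2 * B, fun μ hμ ξ hξ => ?_⟩
  have goal : ‖xpLap μ s b (fun t => p t ξ)‖ ≤ N' / μ + 2 * B / μ := by
    by_cases hmem : ξ ∈ K
    · refine (S.Y_bound μ s ξ hs hμ N' (hKb ξ hmem)).trans ?_
      have : 0 ≤ 2 * B / μ := by positivity
      linarith
    · obtain ⟨c, hc, d, hd, hxc, hdy, hcξ, hξd, hz⟩ := xp_gap K Kc x y (by simp [hK]) (by simp [hK])
        ξ hξ hmem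
      have hO : ∀ z ∈ Ioo c d, z ∈ xpO a b p k C := by
        intro z hz'
        by_contra hcon
        exact hz z hz' (Or.inl ⟨hcon, hxc.trans hz'.1.le, hz'.2.le.trans hdy⟩)
      set H : ℝ → ℂ := fun ξ => (2 * (μ * xpHat μ s b (fun t => C t ξ))
        - q s ξ + Real.exp (-(μ * (b - s))) * q b ξ) with hH
      have cH : Continuous H := by
        have h1 := xpHat_cont μ s b C S.cC
        have h2 := S.cq s
        have h3 := S.cq b
        fun_prop
      refine xp_ode μ hμ c d B (N' / μ) (hcξ.trans hξd) H
        (fun ξ => xpLap μ s b (fun t => p t ξ)) (fun ξ => xpLap μ s b (fun t => k t ξ)) cH ?_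
        (xpLap_cont μ s b p S.cp).continuousOn (fun z _ => S.Y_deriv μ s z)
        (fun z hz' => S.Y1_deriv μ s z hμ.ne' hs (hO z hz'))
        (S.Y_bound μ s c hs hμ N' (hKb c hc)) (S.Y_bound μ s d hs hμ N' (hKb d hd)) ξ
        ⟨hcξ.le, hξd.le⟩
      intro z hz'
      have hz2 : z ∈ Icc x y := ⟨hxc.trans hz'.1, hz'.2.trans hdy⟩
      have b1 : ‖xpHat μ s b (fun t => C t z)‖ ≤ BC / μ :=
        xpHat_norm_le μ s b hμ hs.2 _ BC hBC0 (fun t ht => hBC (t, z) ⟨⟨hs.1.trans ht.1, ht.2⟩, hz2⟩)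
      have b2 : ‖(2 * (μ * xpHat μ s b (fun t => C t z)) : ℂ)‖ ≤ 2 * BC := by
        rw [norm_mul, norm_mul]
        simp only [Complex.norm_ofNat, Complex.norm_real, Real.norm_eq_abs, abs_of_pos hμ]
        rw [le_div_iff₀ hμ] at b1
        linarith
      have b3 : ‖((Real.exp (-(μ * (b - s))) : ℝ) : ℂ) * q b z‖ ≤ Bb := by
        rw [norm_mul, Complex.norm_real, Real.norm_eq_abs, abs_of_pos (Real.exp_pos _)]
        have : Real.exp (-(μ * (b - s))) ≤ 1 := by
          rw [Real.exp_le_one_iff]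
          have := mul_nonneg hμ.le (sub_nonneg.2 hs.2)
          linarith
        calc _ ≤ 1 * ‖q b z‖ := by gcongr
          _ ≤ Bb := by rw [one_mul]; exact hBb z hz2
      refine (norm_add_le _ _).trans ?_
      have := norm_sub_le (2 * (μ * xpHat μ s b (fun t => C t z)) : ℂ) (q s z)
      have := hBs z hz2
      linarith
  rw [norm_smul, Real.norm_eq_abs, abs_of_pos hμ]
  rw [← add_div, le_div_iff₀ hμ] at goal
  linarith

theorem XpSys.lim (S : XpSys a b p k C f q) (s x y : ℝ) (hs : s ∈ Ico a b) (hxy : x < y)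
    (N : ℝ) (hN : ∀ ξ ∈ Icc x y, ξ ∉ xpO a b p k C → ∀ t ∈ Icc a b, ‖f t ξ‖ ≤ N) :
    Tendsto (fun μ : ℝ => μ • xpLap μ s b (fun t => xpD a p k C t y - xpD a p k C t x))
      atTop (𝓝 0) := by
  have hs' : s ∈ Icc a b := ⟨hs.1, hs.2.le⟩
  obtain ⟨M, hM⟩ := S.U_bound s x y hs' hxy N hN
  obtain ⟨BC, hBC⟩ := (isCompact_Icc.prod isCompact_Icc : IsCompact (Icc a b ×ˢ Icc x y)).exists_bound_of_continuousOn
    S.cC.continuousOn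
  have hBC0 : 0 ≤ BC := (norm_nonneg _).trans (hBC (s, x) ⟨hs', le_rfl, hxy.le⟩)
  have t1 : Tendsto (fun μ : ℝ => ∫ ξ in x..y, μ • xpLap μ s b (fun t => p t ξ)) atTop
      (𝓝 (∫ ξ in x..y, f s ξ)) := by
    apply intervalIntegral.tendsto_integral_filter_of_dominated_convergence (fun _ => M)
    · exact Eventually.of_forall fun μ =>
        ((xpLap_cont μ s b p S.cp).const_smul μ).aestronglyMeasurable
    · filter_upwards [eventually_gt_atTop 0] with μ hμ
      refine Eventually.of_forall fun ξ hξ => ?_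
      rw [uIoc_of_le hxy.le] at hξ
      exact hM μ hμ ξ ⟨hξ.1.le, hξ.2⟩
    · exact intervalIntegrable_const
    · refine Eventually.of_forall fun ξ _ => ?_
      simp only [S.Y_eq _ s ξ hs']
      exact xpHat_tendsto s b hs.2 (fun t => f t ξ) ((S.cf ξ).mono (Icc_subset_Icc hs.1 le_rfl))
  have t2 : Tendsto (fun μ : ℝ => ∫ ξ in x..y, μ • xpHat μ s b (fun t => C t ξ)) atTop
      (𝓝 (∫ ξ in x..y, C s ξ)) := by
    apply intervalIntegral.tendsto_integral_filter_of_dominated_convergence (fun _ => BC)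
    · exact Eventually.of_forall fun μ =>
        ((xpHat_cont μ s b C S.cC).const_smul μ).aestronglyMeasurable
    · filter_upwards [eventually_gt_atTop 0] with μ hμ
      refine Eventually.of_forall fun ξ hξ => ?_
      rw [uIoc_of_le hxy.le] at hξ
      have b1 : ‖xpHat μ s b (fun t => C t ξ)‖ ≤ BC / μ :=
        xpHat_norm_le μ s b hμ hs.2.le _ BC hBC0
          (fun t ht => hBC (t, ξ) ⟨⟨hs.1.trans ht.1, ht.2⟩, hξ.1.le, hξ.2⟩)
      rw [norm_smul, Real.norm_eq_abs, abs_of_pos hμ]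
      rw [le_div_iff₀ hμ] at b1
      linarith
    · exact intervalIntegrable_const
    · refine Eventually.of_forall fun ξ _ => ?_
      exact xpHat_tendsto s b hs.2 (fun t => C t ξ) (xp_col C S.cC ξ).continuousOn
  have t3 := fun z => xpHat_tendsto s b hs.2 (fun t => k t z) (xp_col k S.ck z).continuousOn
  have T := ((t1.const_mul Complex.I).add (((t3 y).sub (t3 x)).const_mul (1/2))).sub t2
  have e : Complex.I * (∫ ξ in x..y, f s ξ) + (1/2) * (k s y - k s x) - ∫ ξ in x..y, C s ξ = 0 := by
    rw [← intervalIntegral.integral_eq_sub_of_hasDerivAt (fun z _ => S.dxx s z)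
      ((S.cq s).intervalIntegrable _ _)]
    have ef : ∀ ξ, Complex.I * f s ξ = C s ξ - (1/2) * q s ξ := fun ξ => by
      rw [← S.eq s hs' ξ]; ring
    rw [← intervalIntegral.integral_const_mul]
    simp only [ef]
    rw [intervalIntegral.integral_sub ((xp_row C S.cC s).intervalIntegrable _ _)
      (((S.cq s).const_mul _).intervalIntegrable _ _), intervalIntegral.integral_const_mul]
    ring
  rw [e] at T
  refine T.congr fun μ => ?_
  rw [S.D_lap μ s x y hs.2.le, intervalIntegral.integral_smul, intervalIntegral.integral_smul]
  simp only [Complex.real_smul]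
  ring

theorem XpSys.O_univ (S : XpSys a b p k C f q) : xpO a b p k C = univ := by
  by_contra hne
  have hKne : (xpO a b p k C)ᶜ.Nonempty := by rwa [nonempty_compl]
  have hKc : IsClosed (xpO a b p k C)ᶜ := xpO_open.isClosed_compl
  have : Nonempty ((xpO a b p k C)ᶜ : Set ℝ) := hKne.to_subtype
  have : CompleteSpace ((xpO a b p k C)ᶜ : Set ℝ) := hKc.completeSpace_coe
  obtain ⟨N, hN⟩ := nonempty_interior_of_iUnion_of_closed
    (X := ((xpO a b p k C)ᶜ : Set ℝ)) (f := fun N : ℕ => Subtype.val ⁻¹' (xpA a b p N))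
    (fun N => (S.A_closed N).preimage continuous_subtype_val) (by
      rw [eq_univ_iff_forall]
      intro x
      obtain ⟨N, hN⟩ := S.col_exists x
      exact mem_iUnion.2 ⟨N, S.A_mem x N hN⟩)
  obtain ⟨⟨x0, hx0⟩, hint⟩ := hN
  rw [mem_interior_iff_mem_nhds, nhds_subtype, mem_comap] at hint
  obtain ⟨V, hV, hVA⟩ := hint
  obtain ⟨δ, hδ, hball⟩ := Metric.mem_nhds_iff.1 hV
  have hgood : ∀ ξ ∈ Metric.ball x0 δ, ξ ∉ xpO a b p k C → ∀ t ∈ Icc a b, ‖f t ξ‖ ≤ N := by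
    intro ξ hξ hO
    apply S.A_bound
    exact hVA (show (⟨ξ, hO⟩ : ((xpO a b p k C)ᶜ : Set ℝ)) ∈ Subtype.val ⁻¹' V from hball hξ)
  have key : ∀ x ∈ Metric.ball x0 δ, ∀ y ∈ Metric.ball x0 δ, x < y → ∀ t ∈ Icc a b,
      xpD a p k C t y = xpD a p k C t x := by
    intro x hx y hy hxy t ht
    have hN' : ∀ ξ ∈ Icc x y, ξ ∉ xpO a b p k C → ∀ t ∈ Icc a b, ‖f t ξ‖ ≤ N := by
      intro ξ hξ
      apply hgood
      rw [Real.ball_eq_Ioo] at *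
      exact ⟨hx.1.trans_le hξ.1, hξ.2.trans_lt hy.2⟩
    have hmax := xp_max_complex a b (fun t => xpD a p k C t y - xpD a p k C t x)
      (S.D_cont x y).continuousOn (fun s hs => S.lim s x y hs hxy N hN')
    have h1 := hmax t ht
    have h2 := hmax a ⟨le_rfl, S.hab.le⟩
    have h3 : xpD a p k C a y - xpD a p k C a x = 0 := by simp [xpD]
    rw [← h2, h3] at h1
    exact sub_eq_zero.1 h1
  apply hx0
  show ∀ᶠ y in 𝓝 x0, ∀ t ∈ Icc a b, xpD a p k C t y = xpD a p k C t x0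
  filter_upwards [Metric.ball_mem_nhds x0 hδ] with y hy t ht
  have hx0' := Metric.mem_ball_self (x := x0) hδ
  rcases lt_trichotomy y x0 with h | h | h
  · exact (key y hy x0 hx0' h t ht).symm
  · rw [h]
  · exact key x0 hx0' y hy h t ht

theorem XpSys.D_const (S : XpSys a b p k C f q) (t x : ℝ) (ht : t ∈ Icc a b) :
    xpD a p k C t x = xpD a p k C t 0 := by
  have h : ∀ x, HasDerivAt (fun y => xpD a p k C t y) 0 x := by
    intro x
    have hx : x ∈ xpO a b p k C := by rw [S.O_univ]; trivial
    have hx' : ∀ᶠ y in 𝓝 x, ∀ t ∈ Icc a b, xpD a p k C t y = xpD a p k C t x := hx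
    refine (hasDerivAt_const x (xpD a p k C t x)).congr_of_eventuallyEq ?_
    filter_upwards [hx'] with y hy
    exact hy t ht
  exact is_const_of_deriv_eq_zero (fun x => (h x).differentiableAt) (fun x => (h x).deriv) x 0

theorem XpSys.V_deriv (S : XpSys a b p k C f q) (x : ℝ) :
    HasDerivAt (fun x => ∫ τ in a..b, k τ x)
      (2 * ((∫ τ in a..b, C τ x) - Complex.I * (p b x - p a x))) x := by
  have c1 := xp_row (fun t ξ => p t ξ - p a ξ) S.cpa b
  have c2 := xp_row (fun t ξ => ∫ τ in a..t, C τ ξ) (xp_timeint a C S.cC) b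
  have d1 := (c1.integral_hasStrictDerivAt 0 x).hasDerivAt
  have d2 := (c2.integral_hasStrictDerivAt 0 x).hasDerivAt
  have e : (fun x => ∫ τ in a..b, k τ x) = fun x => 2 * (xpD a p k C b 0 +
      ((∫ ξ in (0:ℝ)..x, ∫ τ in a..b, C τ ξ) - Complex.I * (∫ ξ in (0:ℝ)..x, (p b ξ - p a ξ)))) := by
    funext x
    rw [← S.D_const b x ⟨S.hab.le, le_rfl⟩, xpD]
    ring
  rw [e]
  exact (((d2.sub (d1.const_mul Complex.I)).const_add _).const_mul 2)
end


theorem xp_avg {E : Type*} [NormedAddCommGroup E] [NormedSpace ℝ E] (G : ℝ → E) (s b : ℝ) :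
    ∫ τ in s..b, G τ = (b - s) • ∫ θ in (0:ℝ)..1, G (s + (b - s) * θ) := by
  rw [intervalIntegral.smul_integral_comp_add_mul]
  simp

theorem xp_avg_cont {E : Type*} [NormedAddCommGroup E] [NormedSpace ℝ E] (G : ℝ → ℝ → E)
    (hG : Continuous (fun z : ℝ × ℝ => G z.1 z.2)) (s : ℝ) :
    Continuous (fun z : ℝ × ℝ => ∫ θ in (0:ℝ)..1, G (s + (z.1 - s) * θ) z.2) := by
  apply intervalIntegral.continuous_parametric_intervalIntegral_of_continuous'
    (f := fun (z : ℝ × ℝ) θ => G (s + (z.1 - s) * θ) z.2)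
  exact hG.comp (by fun_prop :
    Continuous fun w : (ℝ × ℝ) × ℝ => (s + (w.1.1 - s) * w.2, w.1.2))

theorem xp_right_deriv (F Φ : ℝ → ℝ) (s : ℝ) (hΦ : Continuous Φ)
    (h : ∀ b, s < b → F b - F s = (b - s) * Φ b) : HasDerivWithinAt F (Φ s) (Ici s) s := by
  rw [hasDerivWithinAt_iff_tendsto_slope]
  have h1 : Tendsto Φ (𝓝[Ici s \ {s}] s) (𝓝 (Φ s)) := hΦ.continuousAt.tendsto.mono_left
    nhdsWithin_le_nhds
  refine h1.congr' ?_
  filter_upwards [self_mem_nhdsWithin] with b hb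
  have hb' : s < b := lt_of_le_of_ne hb.1 (fun h => hb.2 h.symm)
  rw [slope_def_field, h b hb']
  have : b - s ≠ 0 := by linarith
  field_simp

theorem XpSys.mass_id {a b : ℝ} {p k C f q : ℝ → ℝ → ℂ} (S : XpSys a b p k C f q) (L : ℝ)
    (hp : ∀ t x, p t (x + L) = p t x) (hk : ∀ t x, k t (x + L) = k t x) :
    (∫ x in (0:ℝ)..L, ‖p b x‖ ^ 2) - (∫ x in (0:ℝ)..L, ‖p a x‖ ^ 2) =
      (-(Complex.I / 2) * (∫ x in (0:ℝ)..L, star (k b x + k a x) * (∫ τ in a..b, k τ x))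
        - Complex.I * (∫ x in (0:ℝ)..L, star (p b x + p a x) * (∫ τ in a..b, C τ x))).re := by
  have cpb := xp_row p S.cp b
  have cpa := xp_row p S.cp a
  have ckb := xp_row k S.ck b
  have cka := xp_row k S.ck a
  have cV := xp_row (fun t ξ => ∫ τ in a..t, k τ ξ) (xp_timeint a k S.ck) b
  have cC := xp_row (fun t ξ => ∫ τ in a..t, C τ ξ) (xp_timeint a C S.cC) b
  have hη : ∀ x, HasDerivAt (fun x => star (p b x + p a x)) (star (k b x + k a x)) x := fun x =>
    ((S.dx b x).add (S.dx a x)).star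
  have ibp := intervalIntegral.integral_mul_deriv_eq_deriv_mul (a := 0) (b := L)
    (fun x _ => hη x) (fun x _ => S.V_deriv x)
    (by apply Continuous.intervalIntegrable; fun_prop)
    (by apply Continuous.intervalIntegrable; fun_prop)
  have z1 : ∀ t, p t L = p t 0 := fun t => by simpa using hp t 0
  have z2 : ∀ t, k t L = k t 0 := fun t => by simpa using hk t 0
  simp only [z1, z2, sub_self, zero_sub] at ibp
  have e1 : ∀ x, star (p b x + p a x) * (2 * ((∫ τ in a..b, C τ x) - Complex.I * (p b x - p a x)))
      = 2 * (star (p b x + p a x) * (∫ τ in a..b, C τ x))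
        - (2 * Complex.I) * (star (p b x + p a x) * (p b x - p a x)) := fun x => by ring
  simp only [e1] at ibp
  rw [intervalIntegral.integral_sub (by apply Continuous.intervalIntegrable; fun_prop)
    (by apply Continuous.intervalIntegrable; fun_prop), intervalIntegral.integral_const_mul,
    intervalIntegral.integral_const_mul] at ibp
  have e2 : (∫ x in (0:ℝ)..L, ‖p b x‖ ^ 2) - (∫ x in (0:ℝ)..L, ‖p a x‖ ^ 2) =
      (∫ x in (0:ℝ)..L, star (p b x + p a x) * (p b x - p a x)).re := by
    rw [← intervalIntegral.integral_sub (by apply Continuous.intervalIntegrable; fun_prop)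
      (by apply Continuous.intervalIntegrable; fun_prop)]
    have := Complex.reCLM.intervalIntegral_comp_comm (μ := volume) (a := 0) (b := L)
      (f := fun x => star (p b x + p a x) * (p b x - p a x))
      (by apply Continuous.intervalIntegrable; fun_prop)
    rw [Complex.reCLM_apply] at this
    rw [← this]
    congr 1
    funext x
    rw [← Complex.normSq_eq_norm_sq, ← Complex.normSq_eq_norm_sq, Complex.normSq_apply,
      Complex.normSq_apply]
    simp
    ring
  rw [e2]
  congr 1
  linear_combination (Complex.I / 2) * ibp + (∫ x in (0:ℝ)..L, star (p b x + p a x) * (p b x - p a x)) * Complex.I_sq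

theorem xp_mass_deriv {s : ℝ} {p k C f q : ℝ → ℝ → ℂ} (S : ∀ b, s < b → XpSys s b p k C f q) (L : ℝ)
    (hp : ∀ t x, p t (x + L) = p t x) (hk : ∀ t x, k t (x + L) = k t x) :
    HasDerivWithinAt (fun t => ∫ x in (0:ℝ)..L, ‖p t x‖ ^ 2)
      (∫ x in (0:ℝ)..L, (-2 * Complex.I * (star (p s x) * C s x)).re) (Ici s) s := by
  have S0 := S (s+1) (by linarith)
  set Φ : ℝ → ℝ := fun b =>
    (-(Complex.I / 2) * (∫ x in (0:ℝ)..L, star (k b x + k s x) *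
        (∫ θ in (0:ℝ)..1, k (s + (b - s) * θ) x))
      - Complex.I * (∫ x in (0:ℝ)..L, star (p b x + p s x) *
        (∫ θ in (0:ℝ)..1, C (s + (b - s) * θ) x))).re with hΦ
  have cps := xp_row p S0.cp s
  have cks := xp_row k S0.ck s
  have cCs := xp_row C S0.cC s
  have cp := S0.cp
  have ck := S0.ck
  have c1 : Continuous (fun z : ℝ × ℝ => star (k z.1 z.2 + k s z.2) *
        (∫ θ in (0:ℝ)..1, k (s + (z.1 - s) * θ) z.2)) := by
    have h1 := xp_avg_cont k S0.ck s
    have h2 := cks.comp (continuous_snd (X := ℝ) (Y := ℝ))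
    exact (S0.ck.add h2).star.mul h1
  have c2 : Continuous (fun z : ℝ × ℝ => star (p z.1 z.2 + p s z.2) *
        (∫ θ in (0:ℝ)..1, C (s + (z.1 - s) * θ) z.2)) := by
    have h1 := xp_avg_cont C S0.cC s
    have h2 := cps.comp (continuous_snd (X := ℝ) (Y := ℝ))
    exact (S0.cp.add h2).star.mul h1
  have cΦ : Continuous Φ := by
    have h1 := xp_rowint (fun b x => star (k b x + k s x) *
        (∫ θ in (0:ℝ)..1, k (s + (b - s) * θ) x)) c1 0 L
    have h2 := xp_rowint (fun b x => star (p b x + p s x) *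
        (∫ θ in (0:ℝ)..1, C (s + (b - s) * θ) x)) c2 0 L
    exact Complex.continuous_re.comp ((h1.const_mul _).sub (h2.const_mul _))
  have key := xp_right_deriv (fun t => ∫ x in (0:ℝ)..L, ‖p t x‖ ^ 2) Φ s cΦ (by
    intro b hb
    simp only [hΦ]
    rw [(S b hb).mass_id L hp hk]
    have e : ∀ (G η : ℝ → ℝ → ℂ), ∫ x in (0:ℝ)..L, star (η b x + η s x) * (∫ τ in s..b, G τ x)
       = (b - s) * ∫ x in (0:ℝ)..L, star (η b x + η s x) *
          (∫ θ in (0:ℝ)..1, G (s + (b - s) * θ) x) := by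
      intro G η
      rw [← intervalIntegral.integral_const_mul]
      congr 1
      funext x
      rw [xp_avg (fun τ => G τ x), Complex.real_smul]
      push_cast
      ring
    rw [e, e, ← Complex.re_ofReal_mul]
    congr 1
    push_cast
    ring)
  have e : Φ s = ∫ x in (0:ℝ)..L, (-2 * Complex.I * (star (p s x) * C s x)).re := by
    have h2 : ∫ x in (0:ℝ)..L, (-2 * Complex.I * (star (p s x) * C s x)).re =
        (∫ x in (0:ℝ)..L, (-2 * Complex.I * (star (p s x) * C s x))).re := by
      have := Complex.reCLM.intervalIntegral_comp_comm (μ := volume) (a := 0) (b := L)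
        (f := fun x => (-2 * Complex.I * (star (p s x) * C s x)))
        (by apply Continuous.intervalIntegrable; fun_prop)
      rw [Complex.reCLM_apply] at this
      exact this
    rw [h2, intervalIntegral.integral_const_mul]
    simp only [hΦ, sub_self, zero_mul, add_zero, intervalIntegral.integral_const, sub_zero, one_smul]
    have h3 : ∀ x, star (k s x + k s x) * k s x = ((2 * ‖k s x‖ ^ 2 : ℝ) : ℂ) := by
      intro x
      rw [← Complex.normSq_eq_norm_sq]
      push_cast
      rw [Complex.normSq_eq_conj_mul_self]
      simp only [star_add, Complex.star_def]
      ring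
    have h4 : ∀ x, star (p s x + p s x) * C s x = 2 * (star (p s x) * C s x) := by
      intro x
      simp only [star_add]
      ring
    simp only [h3, h4]
    rw [intervalIntegral.integral_ofReal, intervalIntegral.integral_const_mul]
    simp
  rw [← e]
  exact key

end

/-- Lemma 2.3, equality case: for a classical `L`-periodic solution `(ψ, n)` of the
exciton–polariton system on `[0,∞)` with `α = β` and `ε = 1`, the total mass satisfies
`M(t) = e^{-α t} (M(0) - P L / α) + P L / α`, and hence `M(t) → P L / α` as `t → ∞`. -/
theorem stmt_2 (g lam α β R P L : ℝ)
    (hg : 0 < g) (hlam : 0 < lam) (hα : 0 < α) (hβ : 0 < β) (hR : 0 < R) (hP : 0 < P)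
    (hL : 0 < L) (hαβ : α = β)
    (ψ : ℝ → ℝ → ℂ) (n : ℝ → ℝ → ℝ)
    (ψt ψx ψxx : ℝ → ℝ → ℂ) (nt : ℝ → ℝ → ℝ)
    -- `L`-periodicity in space
    (hper_ψ : ∀ t x, ψ t (x + L) = ψ t x)
    (hper_n : ∀ t x, n t (x + L) = n t x)
    -- continuity of the solution
    (hψ_cont : ContinuousOn (fun p : ℝ × ℝ => ψ p.1 p.2) (Set.Ici 0 ×ˢ Set.univ))
    (hn_cont : ContinuousOn (fun p : ℝ × ℝ => n p.1 p.2) (Set.Ici 0 ×ˢ Set.univ))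
    -- `ψ` continuously differentiable in time
    (hψt : ∀ t ∈ Set.Ici (0:ℝ), ∀ x, HasDerivWithinAt (fun s => ψ s x) (ψt t x) (Set.Ici 0) t)
    (hψt_cont : ∀ x, ContinuousOn (fun t => ψt t x) (Set.Ici 0))
    -- `ψ` twice continuously differentiable in space, with `∂ₓψ` continuous in `(t,x)`
    (hψx : ∀ t ∈ Set.Ici (0:ℝ), ∀ x, HasDerivAt (fun y => ψ t y) (ψx t x) x)
    (hψx_cont : ContinuousOn (fun p : ℝ × ℝ => ψx p.1 p.2) (Set.Ici 0 ×ˢ Set.univ))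
    (hψxx : ∀ t ∈ Set.Ici (0:ℝ), ∀ x, HasDerivAt (fun y => ψx t y) (ψxx t x) x)
    (hψxx_cont : ∀ t ∈ Set.Ici (0:ℝ), Continuous (fun x => ψxx t x))
    -- `n` continuously differentiable in time
    (hnt : ∀ t ∈ Set.Ici (0:ℝ), ∀ x, HasDerivWithinAt (fun s => n s x) (nt t x) (Set.Ici 0) t)
    (hnt_cont : ∀ x, ContinuousOn (fun t => nt t x) (Set.Ici 0))
    -- the Gross-Pitaevskii equation for the condensate wave function
    (heq1 : ∀ t ∈ Set.Ici (0:ℝ), ∀ x,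
      Complex.I * ψt t x = -(1/2 : ℂ) * ψxx t x
        + ((g * ‖ψ t x‖ ^ 2 + lam * n t x : ℝ) : ℂ) * ψ t x
        + (Complex.I / 2) * ((R * n t x - α : ℝ) : ℂ) * ψ t x)
    -- the rate equation for the reservoir density, with `ε = 1`
    (heq2 : ∀ t ∈ Set.Ici (0:ℝ), ∀ x,
      nt t x = P - (R * ‖ψ t x‖ ^ 2 + β) * n t x) :
    (∀ t ∈ Set.Ici (0:ℝ),
      (∫ x in (0:ℝ)..L, ‖ψ t x‖ ^ 2) + (∫ x in (0:ℝ)..L, n t x)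
        = Real.exp (-α * t)
            * ((∫ x in (0:ℝ)..L, ‖ψ 0 x‖ ^ 2) + (∫ x in (0:ℝ)..L, n 0 x)
                - P * L / α)
          + P * L / α) ∧
    Filter.Tendsto
      (fun t => (∫ x in (0:ℝ)..L, ‖ψ t x‖ ^ 2) + (∫ x in (0:ℝ)..L, n t x))
      Filter.atTop (nhds (P * L / α)) := by

  subst hαβ
  have mx : ∀ t : ℝ, max t 0 ∈ Set.Ici (0:ℝ) := fun t => Set.mem_Ici.2 (le_max_right _ _)
  have cmx : Continuous (fun z : ℝ × ℝ => (max z.1 0, z.2)) := by fun_prop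
  have mmx : ∀ z : ℝ × ℝ, (max z.1 0, z.2) ∈ (Set.Ici (0:ℝ) ×ˢ (Set.univ : Set ℝ)) :=
    fun z => ⟨mx z.1, Set.mem_univ _⟩
  set p : ℝ → ℝ → ℂ := fun t x => ψ (max t 0) x with hp
  set k : ℝ → ℝ → ℂ := fun t x => ψx (max t 0) x with hk
  set q : ℝ → ℝ → ℂ := fun t x => ψxx (max t 0) x with hq
  set N : ℝ → ℝ → ℝ := fun t x => n (max t 0) x with hN
  have cp : Continuous (fun z : ℝ × ℝ => p z.1 z.2) := hψ_cont.comp_continuous cmx mmx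
  have ck : Continuous (fun z : ℝ × ℝ => k z.1 z.2) := hψx_cont.comp_continuous cmx mmx
  have cN : Continuous (fun z : ℝ × ℝ => N z.1 z.2) := hn_cont.comp_continuous cmx mmx
  set C : ℝ → ℝ → ℂ := fun t x => ((g * ‖p t x‖ ^ 2 + lam * N t x : ℝ) : ℂ) * p t x
        + (Complex.I / 2) * ((R * N t x - α : ℝ) : ℂ) * p t x with hC
  set G : ℝ → ℝ → ℝ := fun t x => P - (R * ‖p t x‖ ^ 2 + α) * N t x with hG
  have cC : Continuous (fun z : ℝ × ℝ => C z.1 z.2) := by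
    simp only [hC]
    have : Continuous (fun z : ℝ × ℝ => ((g * ‖p z.1 z.2‖ ^ 2 + lam * N z.1 z.2 : ℝ) : ℂ)) :=
      Complex.continuous_ofReal.comp (by fun_prop)
    have h2 : Continuous (fun z : ℝ × ℝ => ((R * N z.1 z.2 - α : ℝ) : ℂ)) :=
      Complex.continuous_ofReal.comp (by fun_prop)
    exact (this.mul cp).add ((continuous_const.mul h2).mul cp)
  have cG : Continuous (fun z : ℝ × ℝ => G z.1 z.2) := by
    simp only [hG]; fun_prop
  have S : ∀ s, 0 ≤ s → ∀ b, s < b → XpSys s b p k C ψt q := by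
    intro s hs b hsb
    refine ⟨hsb, cp, ck, cC, ?_, ?_, ?_, ?_, ?_, ?_⟩
    · intro t ht x
      have ht0 : 0 < t := hs.trans_lt ht.1
      refine ((hψt t ht0.le x).hasDerivAt (Ici_mem_nhds ht0)).congr_of_eventuallyEq ?_
      filter_upwards [Ici_mem_nhds ht0] with u hu
      simp only [hp]; rw [max_eq_left hu]
    · exact fun x => (hψt_cont x).mono fun t ht => hs.trans ht.1
    · exact fun t x => hψx _ (mx t) x
    · exact fun t x => hψxx _ (mx t) x
    · exact fun t => hψxx_cont _ (mx t)
    · intro t ht x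
      have ht0 : 0 ≤ t := hs.trans ht.1
      simp only [hC, hp, hN, hq, max_eq_left ht0]
      rw [heq1 t ht0 x]
      ring
  have hpp : ∀ t x, p t (x + L) = p t x := fun t x => hper_ψ _ x
  have hkp : ∀ t x, k t (x + L) = k t x := by
    intro t x
    have h1 : HasDerivAt (fun y => ψ (max t 0) (y + L)) (ψx (max t 0) (x + L)) x :=
      (hψx _ (mx t) (x + L)).comp_add_const x L
    simp only [hper_ψ] at h1
    exact h1.unique (hψx _ (mx t) x)
  set M : ℝ → ℝ := fun t => (∫ x in (0:ℝ)..L, ‖p t x‖ ^ 2) + ∫ x in (0:ℝ)..L, N t x with hM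
  have cM : Continuous M := by
    have h1 : Continuous (fun t => ∫ x in (0:ℝ)..L, ‖p t x‖ ^ 2) :=
      intervalIntegral.continuous_parametric_intervalIntegral_of_continuous'
        (f := fun t x => ‖p t x‖ ^ 2) (by unfold Function.uncurry; fun_prop) 0 L
    have h2 : Continuous (fun t => ∫ x in (0:ℝ)..L, N t x) :=
      intervalIntegral.continuous_parametric_intervalIntegral_of_continuous'
        (f := N) cN 0 L
    exact h1.add h2
  have hNd : ∀ s, 0 ≤ s → HasDerivWithinAt (fun t => ∫ x in (0:ℝ)..L, N t x)
      (∫ x in (0:ℝ)..L, G s x) (Set.Ici s) s := by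
    intro s hs
    have ca := xp_avg_cont G cG s
    have h := xp_right_deriv (fun t => ∫ x in (0:ℝ)..L, N t x)
      (fun b => ∫ x in (0:ℝ)..L, ∫ θ in (0:ℝ)..1, G (s + (b - s) * θ) x) s
      (intervalIntegral.continuous_parametric_intervalIntegral_of_continuous'
        (f := fun b x => ∫ θ in (0:ℝ)..1, G (s + (b - s) * θ) x) ca 0 L) (by
        intro b hb
        have r : ∀ t, Continuous (N t) := fun t =>
          cN.comp (by fun_prop : Continuous fun ξ : ℝ => (t, ξ))
        rw [← intervalIntegral.integral_sub ((r b).intervalIntegrable _ _)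
          ((r s).intervalIntegrable _ _), ← intervalIntegral.integral_const_mul]
        congr 1
        funext x
        have e := xp_avg (fun τ => G τ x) s b
        rw [smul_eq_mul] at e
        rw [← e]
        symm
        apply intervalIntegral.integral_eq_sub_of_hasDerivAt_of_le hb.le
        · exact (cN.comp (by fun_prop : Continuous fun t : ℝ => (t, x))).continuousOn
        · intro t ht
          have ht0 : 0 < t := hs.trans_lt ht.1
          have : G t x = nt t x := by
            simp only [hG, hp, hN, max_eq_left ht0.le]
            rw [heq2 t ht0.le x]
          rw [this]
          refine ((hnt t ht0.le x).hasDerivAt (Ici_mem_nhds ht0)).congr_of_eventuallyEq ?_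
          filter_upwards [Ici_mem_nhds ht0] with u hu
          simp only [hN]; rw [max_eq_left hu]
        · exact (cG.comp (by fun_prop : Continuous fun t : ℝ => (t, x))).intervalIntegrable _ _)
    simpa using h
  have hMd : ∀ s, 0 ≤ s → HasDerivWithinAt M (P * L - α * M s) (Set.Ici s) s := by
    intro s hs
    have h1 := (xp_mass_deriv (S s hs) L hpp hkp).add (hNd s hs)
    refine HasDerivWithinAt.congr_deriv h1 ?_
    have rp : Continuous (p s) := cp.comp (by fun_prop : Continuous fun ξ : ℝ => (s, ξ))
    have rN : Continuous (N s) := cN.comp (by fun_prop : Continuous fun ξ : ℝ => (s, ξ))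
    have e1 : ∀ x, (-2 * Complex.I * (star (p s x) * C s x)).re = (R * N s x - α) * ‖p s x‖ ^ 2 := by
      intro x
      simp only [hC]
      rw [← Complex.normSq_eq_norm_sq (p s x), Complex.normSq_apply]
      simp
      ring
    have e2 : P * L = ∫ x in (0:ℝ)..L, P := by simp; ring
    simp only [e1, hG, hM]
    rw [mul_add, e2, ← intervalIntegral.integral_const_mul, ← intervalIntegral.integral_const_mul,
      ← intervalIntegral.integral_add, ← intervalIntegral.integral_add,
      ← intervalIntegral.integral_sub]
    · congr 1
      funext x
      ring
    all_goals apply Continuous.intervalIntegrable; fun_prop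
  have hE : ∀ s, 0 ≤ s → HasDerivWithinAt (fun t => Real.exp (α * t) * (M t - P * L / α)) 0
      (Set.Ici s) s := by
    intro s hs
    have h0 : HasDerivAt (fun t : ℝ => Real.exp (α * t)) (Real.exp (α * s) * (α * 1)) s :=
      ((hasDerivAt_id s).const_mul α).exp
    refine HasDerivWithinAt.congr_deriv
      (h0.hasDerivWithinAt.mul ((hMd s hs).sub_const (P * L / α))) ?_
    field_simp
    ring
  have main : ∀ t, 0 ≤ t → M t = Real.exp (-α * t) * (M 0 - P * L / α) + P * L / α := by
    intro t ht
    have h := constant_of_has_deriv_right_zero (a := 0) (b := t)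
      (f := fun t => Real.exp (α * t) * (M t - P * L / α)) (by fun_prop)
      (fun s hs => hE s hs.1) t ⟨ht, le_rfl⟩
    simp only [mul_zero, Real.exp_zero, one_mul] at h
    rw [← h, ← mul_assoc, ← Real.exp_add]
    simp
  have hM' : ∀ t, 0 ≤ t → M t = (∫ x in (0:ℝ)..L, ‖ψ t x‖ ^ 2) + (∫ x in (0:ℝ)..L, n t x) := by
    intro t ht
    simp only [hM, hp, hN, max_eq_left ht]
  refine ⟨fun t ht => ?_, ?_⟩
  · rw [← hM' t ht, ← hM' 0 le_rfl]
    exact main t ht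
  · have h1 : Filter.Tendsto (fun t : ℝ => Real.exp (-α * t) * (M 0 - P * L / α) + P * L / α)
        Filter.atTop (nhds (0 * (M 0 - P * L / α) + P * L / α)) := by
      refine Filter.Tendsto.add_const _ (Filter.Tendsto.mul_const _ ?_)
      have := xp_tendsto_exp α hα
      refine this.congr fun t => ?_
      congr 1
      ring
    rw [zero_mul, zero_add] at h1
    refine h1.congr' ?_
    filter_upwards [Filter.eventually_ge_atTop 0] with t ht
    rw [← main t ht, hM' t ht]
end

section
/- Let ε, P, β > 0 and let a : [0,T) → ℝ be a continuous nonnegative function. If n : [0,T) → ℝ is differentiable and satisfies ε·n'(t) = P − (a(t) + β)·n(t) for all t ∈ [0,T), then n(t)² ≤ e^{−tβ/ε}·(n(0)² − P²/β²) + P²/β² for all t ∈ [0,T). -/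
/-- Pointwise (in x) form of Lemma 2.4: the uniform bound
`n(t)² ≤ e^{-tβ/ε} (n(0)² - P²/β²) + P²/β²` for the reservoir equation
`ε n' = P - (a + β) n` with `a ≥ 0`. -/
theorem stmt_3 (ε P β T : ℝ) (hε : 0 < ε) (hP : 0 < P) (hβ : 0 < β)
    (a n n' : ℝ → ℝ)
    (ha_cont : ContinuousOn a (Set.Ico 0 T))
    (ha_nonneg : ∀ t ∈ Set.Ico (0:ℝ) T, 0 ≤ a t)
    (hderiv : ∀ t ∈ Set.Ico (0:ℝ) T, HasDerivWithinAt n (n' t) (Set.Ico 0 T) t)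
    (heq : ∀ t ∈ Set.Ico (0:ℝ) T, ε * n' t = P - (a t + β) * n t) :
    ∀ t ∈ Set.Ico (0:ℝ) T,
      (n t) ^ 2 ≤ Real.exp (-t * β / ε) * ((n 0) ^ 2 - P ^ 2 / β ^ 2) + P ^ 2 / β ^ 2 := by
  have hg : ∀ t ∈ Set.Ico (0:ℝ) T, HasDerivWithinAt
      (fun t => Real.exp (t * (β / ε)) * ((n t) ^ 2 - P ^ 2 / β ^ 2))
      (Real.exp (t * (β / ε)) * (β / ε) * ((n t) ^ 2 - P ^ 2 / β ^ 2)
        + Real.exp (t * (β / ε)) * (2 * n t * n' t)) (Set.Ico 0 T) t := by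
    intro t ht
    have h1 : HasDerivAt (fun t : ℝ => Real.exp (t * (β / ε)))
        (Real.exp (t * (β / ε)) * (β / ε)) t := by
      simpa using ((hasDerivAt_id t).mul_const (β / ε)).exp
    have h2 : HasDerivWithinAt (fun t => (n t) ^ 2 - P ^ 2 / β ^ 2) (2 * n t * n' t)
        (Set.Ico 0 T) t := by
      simpa using ((hderiv t ht).pow 2).sub_const (P ^ 2 / β ^ 2)
    exact h1.hasDerivWithinAt.mul h2
  have hanti : AntitoneOn (fun t => Real.exp (t * (β / ε)) * ((n t) ^ 2 - P ^ 2 / β ^ 2))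
      (Set.Ico 0 T) := by
    refine antitoneOn_of_hasDerivWithinAt_nonpos (convex_Ico 0 T)
      (fun t ht => (hg t ht).continuousWithinAt)
      (fun t ht => (hg t (interior_subset ht)).mono interior_subset) ?_
    intro t ht
    have ht' := interior_subset ht
    have ha := ha_nonneg t ht'
    have hn' : n' t = (P - (a t + β) * n t) / ε := by
      rw [← heq t ht']; field_simp
    have key : Real.exp (t * (β / ε)) * (β / ε) * ((n t) ^ 2 - P ^ 2 / β ^ 2)
        + Real.exp (t * (β / ε)) * (2 * n t * n' t)
        = -(Real.exp (t * (β / ε)) / ε * ((β * n t - P) ^ 2 / β + 2 * a t * (n t) ^ 2)) := by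
      rw [hn']; field_simp; ring
    rw [key]
    have : 0 ≤ Real.exp (t * (β / ε)) / ε * ((β * n t - P) ^ 2 / β + 2 * a t * (n t) ^ 2) := by
      positivity
    linarith
  intro t ht
  have h := hanti ⟨le_refl 0, ht.1.trans_lt ht.2⟩ ht ht.1
  simp only [zero_mul, Real.exp_zero, one_mul] at h
  have h3 := mul_le_mul_of_nonneg_left h (Real.exp_pos (-t * β / ε)).le
  have h4 : Real.exp (-t * β / ε) * Real.exp (t * (β / ε)) = 1 := by
    rw [← Real.exp_add, ← Real.exp_zero]; congr 1; ring
  rw [← mul_assoc, h4] at h3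
  linarith
end

section
/- Let (ψ, n) be a smooth classical L-periodic solution of the exciton–polariton system on [0,T) with n(t,x) > 0 for all t ∈ [0,T) and all x. Define the energy-type functional F(t) = ∫₀^L [ (1/2)|∂ₓψ(t,x)|² + (g/2)|ψ(t,x)|⁴ + λ n(t,x)|ψ(t,x)|² ] dx + (ε/2)∫₀^L (∂ₓ√(n(t,x)))² dx − (λP/R)∫₀^L ln n(t,x) dx + (βλ/R)∫₀^L n(t,x) dx. Then there exist constants C₁ > 0 and C₂ ≥ 0 such that F(t) ≤ e^{C₁ t}·(F(0) + C₂/C₁) − C₂/C₁ for all t ∈ [0,T). -/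
open Set

noncomputable def px (f : ℝ × ℝ → ℝ) (p : ℝ × ℝ) : ℝ := deriv (fun y => f (p.1, y)) p.2
noncomputable def pt (f : ℝ × ℝ → ℝ) (p : ℝ × ℝ) : ℝ := deriv (fun s => f (s, p.2)) p.1

lemma slabS_unique (T : ℝ) : UniqueDiffOn ℝ (Ico (0:ℝ) T ×ˢ (univ : Set ℝ)) :=
  (uniqueDiffOn_Ico 0 T).prod uniqueDiffOn_univ

lemma slab_hasDerivAt_x {E : Type*} [NormedAddCommGroup E] [NormedSpace ℝ E]
    {T : ℝ} {f : ℝ × ℝ → E}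
    (hf : ContDiffOn ℝ (⊤ : ℕ∞) f (Ico 0 T ×ˢ univ)) {t x : ℝ} (ht : t ∈ Ico 0 T) :
    HasDerivAt (fun y => f (t, y)) (fderivWithin ℝ f (Ico 0 T ×ˢ univ) (t, x) (0, 1)) x := by
  have h1 : HasFDerivWithinAt f (fderivWithin ℝ f (Ico 0 T ×ˢ univ) (t, x)) (Ico 0 T ×ˢ univ) (t, x) :=
    ((hf (t, x) ⟨ht, mem_univ _⟩).differentiableWithinAt (by simp)).hasFDerivWithinAt
  have h2 : HasDerivWithinAt (fun y : ℝ => (t, y)) ((0:ℝ), (1:ℝ)) univ x :=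
    ((hasDerivAt_const x t).prodMk (hasDerivAt_id x)).hasDerivWithinAt
  have := h1.comp_hasDerivWithinAt x h2 (fun y _ => ⟨ht, mem_univ _⟩)
  exact this.hasDerivAt (by simp)

lemma px_contDiffOn {T : ℝ} {f : ℝ × ℝ → ℝ}
    (hf : ContDiffOn ℝ (⊤ : ℕ∞) f (Ico 0 T ×ˢ univ)) :
    ContDiffOn ℝ (⊤ : ℕ∞) (px f) (Ico 0 T ×ˢ univ) := by
  have h := (hf.fderivWithin (m := (⊤ : ℕ∞)) (slabS_unique T) (by simp)).clm_apply
    (contDiffOn_const (c := ((0:ℝ), (1:ℝ))))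
  refine h.congr ?_
  rintro ⟨t, x⟩ ⟨ht, _⟩
  exact (slab_hasDerivAt_x hf ht).deriv

lemma px_hasDerivAt {T : ℝ} {f : ℝ × ℝ → ℝ}
    (hf : ContDiffOn ℝ (⊤ : ℕ∞) f (Ico 0 T ×ˢ univ)) {t x : ℝ} (ht : t ∈ Ico 0 T) :
    HasDerivAt (fun y => f (t, y)) (px f (t, x)) x :=
  (slab_hasDerivAt_x hf ht).differentiableAt.hasDerivAt

lemma slabU_open (T : ℝ) : IsOpen (Ioo (0:ℝ) T ×ˢ (univ : Set ℝ)) := isOpen_Ioo.prod isOpen_univ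

lemma slabU_at {T : ℝ} {f : ℝ × ℝ → ℝ}
    (hf : ContDiffOn ℝ (⊤ : ℕ∞) f (Ioo 0 T ×ˢ univ)) {t x : ℝ} (ht : t ∈ Ioo 0 T) :
    ContDiffAt ℝ (⊤ : ℕ∞) f (t, x) :=
  hf.contDiffAt ((slabU_open T).mem_nhds ⟨ht, mem_univ _⟩)

lemma at_x {f : ℝ × ℝ → ℝ} {t x : ℝ} (hf : DifferentiableAt ℝ f (t, x)) :
    HasDerivAt (fun y => f (t, y)) (fderiv ℝ f (t, x) (0, 1)) x :=
  hf.hasFDerivAt.comp_hasDerivAt x ((hasDerivAt_const x t).prodMk (hasDerivAt_id x))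

lemma at_t {f : ℝ × ℝ → ℝ} {t x : ℝ} (hf : DifferentiableAt ℝ f (t, x)) :
    HasDerivAt (fun s => f (s, x)) (fderiv ℝ f (t, x) (1, 0)) t :=
  hf.hasFDerivAt.comp_hasDerivAt t ((hasDerivAt_id t).prodMk (hasDerivAt_const t x))

lemma pt_contDiffOn {T : ℝ} {f : ℝ × ℝ → ℝ}
    (hf : ContDiffOn ℝ (⊤ : ℕ∞) f (Ioo 0 T ×ˢ univ)) :
    ContDiffOn ℝ (⊤ : ℕ∞) (pt f) (Ioo 0 T ×ˢ univ) := by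
  have h := (hf.fderiv_of_isOpen (m := (⊤ : ℕ∞)) (slabU_open T) (by simp)).clm_apply
    (contDiffOn_const (c := ((1:ℝ), (0:ℝ))))
  refine h.congr ?_
  rintro ⟨t, x⟩ ⟨ht, _⟩
  exact (at_t ((slabU_at hf ht).differentiableAt (by simp))).deriv

lemma px_contDiffOn_U {T : ℝ} {f : ℝ × ℝ → ℝ}
    (hf : ContDiffOn ℝ (⊤ : ℕ∞) f (Ioo 0 T ×ˢ univ)) :
    ContDiffOn ℝ (⊤ : ℕ∞) (px f) (Ioo 0 T ×ˢ univ) := by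
  have h := (hf.fderiv_of_isOpen (m := (⊤ : ℕ∞)) (slabU_open T) (by simp)).clm_apply
    (contDiffOn_const (c := ((0:ℝ), (1:ℝ))))
  refine h.congr ?_
  rintro ⟨t, x⟩ ⟨ht, _⟩
  exact (at_x ((slabU_at hf ht).differentiableAt (by simp))).deriv

lemma U_dt {T : ℝ} {f : ℝ × ℝ → ℝ}
    (hf : ContDiffOn ℝ (⊤ : ℕ∞) f (Ioo 0 T ×ˢ univ)) {t x : ℝ} (ht : t ∈ Ioo 0 T) :
    HasDerivAt (fun s => f (s, x)) (pt f (t, x)) t :=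
  (at_t ((slabU_at hf ht).differentiableAt (by simp))).differentiableAt.hasDerivAt

lemma U_dx {T : ℝ} {f : ℝ × ℝ → ℝ}
    (hf : ContDiffOn ℝ (⊤ : ℕ∞) f (Ioo 0 T ×ˢ univ)) {t x : ℝ} (ht : t ∈ Ioo 0 T) :
    HasDerivAt (fun y => f (t, y)) (px f (t, x)) x :=
  (at_x ((slabU_at hf ht).differentiableAt (by simp))).differentiableAt.hasDerivAt

lemma mixed {T : ℝ} {f : ℝ × ℝ → ℝ}
    (hf : ContDiffOn ℝ (⊤ : ℕ∞) f (Ioo 0 T ×ˢ univ)) {t x : ℝ} (ht : t ∈ Ioo 0 T) :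
    pt (px f) (t, x) = px (pt f) (t, x) := by
  have hsym : IsSymmSndFDerivAt ℝ f (t, x) := (slabU_at hf ht).isSymmSndFDerivAt
    (by simp; exact WithTop.coe_le_coe.2 (le_top : (2:ℕ∞) ≤ ⊤))
  have hd : DifferentiableAt ℝ (fderiv ℝ f) (t, x) :=
    ((hf.fderiv_of_isOpen (m := (⊤ : ℕ∞)) (slabU_open T) (by simp)).contDiffAt
      ((slabU_open T).mem_nhds ⟨ht, mem_univ _⟩)).differentiableAt (by simp)
  have e1 : px f =ᶠ[nhds (t, x)] fun p => fderiv ℝ f p (0, 1) := by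
    filter_upwards [(slabU_open T).mem_nhds (show (t, x) ∈ _ from ⟨ht, mem_univ _⟩)]
    rintro ⟨s, y⟩ ⟨hs, _⟩
    exact (at_x ((slabU_at hf hs).differentiableAt (by simp))).deriv
  have e2 : pt f =ᶠ[nhds (t, x)] fun p => fderiv ℝ f p (1, 0) := by
    filter_upwards [(slabU_open T).mem_nhds (show (t, x) ∈ _ from ⟨ht, mem_univ _⟩)]
    rintro ⟨s, y⟩ ⟨hs, _⟩
    exact (at_t ((slabU_at hf hs).differentiableAt (by simp))).deriv
  have h1 : pt (px f) (t, x) = fderiv ℝ (px f) (t, x) (1, 0) :=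
    (at_t ((slabU_at (px_contDiffOn_U hf) ht).differentiableAt (by simp))).deriv
  have h2 : px (pt f) (t, x) = fderiv ℝ (pt f) (t, x) (0, 1) :=
    (at_x ((slabU_at (pt_contDiffOn hf) ht).differentiableAt (by simp))).deriv
  rw [h1, h2, e1.fderiv_eq, e2.fderiv_eq]
  rw [fderiv_clm_apply hd (by fun_prop), fderiv_clm_apply hd (by fun_prop)]
  simpa using hsym.eq (1, 0) (0, 1)

lemma slab_int_cont {T L : ℝ} {G : ℝ × ℝ → ℝ}
    (hG : ContinuousOn G (Ico 0 T ×ˢ univ)) :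
    ContinuousOn (fun t => ∫ x in (0:ℝ)..L, G (t, x)) (Ico 0 T) := by
  rw [continuousOn_iff_continuous_domRestrict]
  apply intervalIntegral.continuous_parametric_intervalIntegral_of_continuous'
    (f := fun (s : Ico (0:ℝ) T) x => G (s.1, x))
  exact hG.comp_continuous (f := fun q : Ico (0:ℝ) T × ℝ => (q.1.1, q.2)) (by fun_prop)
    (fun q => ⟨q.1.2, mem_univ _⟩)

lemma slab_slice {I : Set ℝ} {G : ℝ × ℝ → ℝ}
    (hG : ContinuousOn G (I ×ˢ univ)) {t : ℝ} (ht : t ∈ I) : Continuous (fun x => G (t, x)) :=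
  hG.comp_continuous (by fun_prop) (fun q => ⟨ht, mem_univ _⟩)

lemma slab_int_deriv {T L : ℝ} {G : ℝ × ℝ → ℝ}
    (hG : ContDiffOn ℝ (⊤ : ℕ∞) G (Ioo 0 T ×ˢ univ)) {t : ℝ} (ht : t ∈ Ioo 0 T) :
    HasDerivAt (fun t => ∫ x in (0:ℝ)..L, G (t, x)) (∫ x in (0:ℝ)..L, pt G (t, x)) t := by
  obtain ⟨a, b, hab, hnhds, hsub⟩ := exists_Icc_mem_subset_of_mem_nhds (isOpen_Ioo.mem_nhds ht)
  have hK : IsCompact (Icc a b ×ˢ uIcc 0 L) := isCompact_Icc.prod isCompact_uIcc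
  have hc := (pt_contDiffOn hG).continuousOn
  obtain ⟨C, hC⟩ := hK.exists_bound_of_continuousOn (f := pt G)
    (hc.mono (prod_mono hsub (subset_univ _)))
  refine (intervalIntegral.hasDerivAt_integral_of_dominated_loc_of_deriv_le
    (F := fun t x => G (t, x)) (F' := fun t x => pt G (t, x)) (bound := fun _ => C) hnhds ?_ ?_ ?_ ?_ ?_ ?_).2
  · filter_upwards [hnhds] with s hs
    exact (slab_slice hG.continuousOn (hsub hs)).aestronglyMeasurable
  · exact (slab_slice hG.continuousOn ht).intervalIntegrable _ _
  · exact (slab_slice hc ht).aestronglyMeasurable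
  · refine Filter.Eventually.of_forall fun x hx s hs => hC (s, x) ⟨hs, uIoc_subset_uIcc hx⟩
  · simp
  · exact Filter.Eventually.of_forall fun x hx s hs => U_dt hG (hsub hs)

lemma gron {T C₁ C₂ : ℝ} (hC : 0 < C₁) {F F' : ℝ → ℝ} (hc : ContinuousOn F (Ico 0 T))
    (hd : ∀ t ∈ Ioo 0 T, HasDerivAt F (F' t) t) (hb : ∀ t ∈ Ioo 0 T, F' t ≤ C₁ * F t + C₂)
    {t : ℝ} (ht : t ∈ Ico 0 T) :
    F t ≤ Real.exp (C₁ * t) * (F 0 + C₂ / C₁) - C₂ / C₁ := by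
  have hd2 : ∀ t ∈ Ioo 0 T, HasDerivAt (fun s => Real.exp (-(C₁ * s)) * (F s + C₂ / C₁))
      (Real.exp (-(C₁ * t)) * (-(C₁ * 1)) * (F t + C₂ / C₁) + Real.exp (-(C₁ * t)) * F' t) t := by
    intro t ht
    exact (((hasDerivAt_id t).const_mul C₁).neg.exp).mul ((hd t ht).add_const _)
  have hanti : AntitoneOn (fun s => Real.exp (-(C₁ * s)) * (F s + C₂ / C₁)) (Ico 0 T) := by
    apply antitoneOn_of_deriv_nonpos (convex_Ico 0 T)
    · fun_prop
    · rw [interior_Ico]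
      exact fun t ht => (hd2 t ht).differentiableAt.differentiableWithinAt
    · rw [interior_Ico]
      intro t ht
      rw [(hd2 t ht).deriv]
      have h1 := hb t ht
      have h2 := Real.exp_pos (-(C₁ * t))
      have : C₁ * (C₂ / C₁) = C₂ := by field_simp
      nlinarith
  have h := hanti (⟨le_rfl, ht.1.trans_lt ht.2⟩ : (0:ℝ) ∈ Ico 0 T) ht ht.1
  simp only [mul_zero, neg_zero, Real.exp_zero, one_mul] at h
  have h3 := mul_le_mul_of_nonneg_left h (Real.exp_pos (C₁ * t)).le
  rw [← mul_assoc, ← Real.exp_add] at h3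
  simp at h3
  linarith

/-- the pointwise energy inequality -/
lemma alg {g lam α β R P ε N u v w ux vx wx ut vt wt uxx vxx uxt vxt wxt ln : ℝ}
    (hg : 0 < g) (hlam : 0 < lam) (hα : 0 < α) (hβ : 0 < β) (hR : 0 < R) (hP : 0 < P)
    (hε : 0 < ε) (hw : 0 < w) (hN : w ^ 2 ≤ N) (hln : ln ≤ N)
    (E1 : vt = (1/2) * uxx - (g * (u^2+v^2) + lam * w^2) * u + (1/2) * (R * w^2 - α) * v)
    (E2 : ut = -(1/2) * vxx + (g * (u^2+v^2) + lam * w^2) * v + (1/2) * (R * w^2 - α) * u)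
    (E3 : ε * (2 * w * wt) = P - (R * (u^2+v^2) + β) * w^2)
    (E4 : ε * (2 * (wx * wt + w * wxt)) = - (R * (2 * u * ux + 2 * v * vx) * w^2
      + (R * (u^2+v^2) + β) * (2 * w * wx))) :
    ux * uxt + vx * vxt + 2 * g * (u^2+v^2) * (u * ut + v * vt)
      + lam * (2 * w * wt * (u^2+v^2) + w^2 * (2 * (u * ut + v * vt)))
      + ε * wx * wxt - (lam * P / R) * (2 * w * wt / w^2) + (β * lam / R) * (2 * w * wt)
    ≤ (uxx * ut + ux * uxt + vxx * vt + vx * vxt - R * w * wx * (ux * u + vx * v)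
      - (1/2) * (R * w^2 - α) * (uxx * u + ux * ux + vxx * v + vx * vx))
      + 2 * R * N * (((1/2) * (ux^2 + vx^2) + (g/2) * (u^2+v^2)^2 + lam * w^2 * (u^2+v^2)
        + (ε/2) * wx^2 - (lam * P / R) * ln + (β * lam / R) * w^2) + (lam * P / R) * N) := by
  have key : ux * uxt + vx * vxt + 2 * g * (u^2+v^2) * (u * ut + v * vt)
      + lam * (2 * w * wt * (u^2+v^2) + w^2 * (2 * (u * ut + v * vt)))
      + ε * wx * wxt - (lam * P / R) * (2 * w * wt / w^2) + (β * lam / R) * (2 * w * wt)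
    = (uxx * ut + ux * uxt + vxx * vt + vx * vxt - R * w * wx * (ux * u + vx * v)
      - (1/2) * (R * w^2 - α) * (uxx * u + ux * ux + vxx * v + vx * vx))
      + (R * w^2 - α) * ((1/2) * (ux^2 + vx^2) + g * (u^2+v^2)^2 + lam * w^2 * (u^2+v^2))
      - (lam * ε / R) * (4 * wt^2) - (1/2) * (P / w^2 + R * (u^2+v^2) + β) * wx^2 := by
    have hP' : P = ε * (2 * w * wt) + (R * (u^2+v^2) + β) * w^2 := by linarith
    have hx : wxt = (-(R * (u * ux + v * vx) * w^2 + (R * (u^2+v^2) + β) * (w * wx)) / ε - wx * wt) / w := by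
      field_simp
      linarith
    rw [hx, hP', E1, E2]
    field_simp
    ring
  rw [key]
  have a1 : 0 ≤ (lam * ε / R) * (4 * wt^2) := by positivity
  have a2 : 0 ≤ (1/2) * (P / w^2 + R * (u^2+v^2) + β) * wx^2 := by positivity
  have a3 : (R * w^2 - α) * ((1/2) * (ux^2 + vx^2) + g * (u^2+v^2)^2 + lam * w^2 * (u^2+v^2))
      ≤ (R * N) * ((1/2) * (ux^2 + vx^2) + g * (u^2+v^2)^2 + lam * w^2 * (u^2+v^2)) := by
    apply mul_le_mul_of_nonneg_right _ (by positivity)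
    nlinarith
  have a4 : (R * N) * ((1/2) * (ux^2 + vx^2) + g * (u^2+v^2)^2 + lam * w^2 * (u^2+v^2)) ≤
     (R * N) * (2 * (((1/2) * (ux^2 + vx^2) + (g/2) * (u^2+v^2)^2 + lam * w^2 * (u^2+v^2)
        + (ε/2) * wx^2 - (lam * P / R) * ln + (β * lam / R) * w^2) + (lam * P / R) * N)) := by
    have hN0 : 0 < N := lt_of_lt_of_le (by positivity) hN
    apply mul_le_mul_of_nonneg_left _ (by positivity)
    have b1 : 0 ≤ (lam * P / R) * (N - ln) := mul_nonneg (by positivity) (by linarith)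
    have b2 : 0 ≤ (ε/2) * wx^2 := by positivity
    have b3 : 0 ≤ (β * lam / R) * w^2 := by positivity
    have b4 : 0 ≤ lam * w^2 * (u^2+v^2) := by positivity
    have b5 : 0 ≤ ux^2 + vx^2 := by positivity
    linarith
  linarith

noncomputable def Phi (g lam β R P ε : ℝ) (u v w : ℝ × ℝ → ℝ) (p : ℝ × ℝ) : ℝ :=
  (1/2) * (px u p ^ 2 + px v p ^ 2) + (g/2) * (u p ^ 2 + v p ^ 2) ^ 2
    + lam * w p ^ 2 * (u p ^ 2 + v p ^ 2)
    + (ε/2) * px w p ^ 2 - (lam * P / R) * Real.log (w p ^ 2) + (β * lam / R) * w p ^ 2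

noncomputable def Qf (α R : ℝ) (u v w : ℝ × ℝ → ℝ) (p : ℝ × ℝ) : ℝ :=
  px u p * pt u p + px v p * pt v p
    - (1/2) * (R * w p ^ 2 - α) * (px u p * u p + px v p * v p)

lemma px_per {f : ℝ × ℝ → ℝ} {t L : ℝ} (h : ∀ x, f (t, x + L) = f (t, x)) :
    px f (t, L) = px f (t, 0) := by
  have h1 : (fun y => f (t, y)) = fun y => f (t, y + L) := funext fun y => (h y).symm
  have h2 := deriv_comp_add_const (fun y => f (t, y)) L 0
  simp only [px]
  rw [zero_add] at h2
  rw [← h2, ← h1]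

lemma pt_per {f : ℝ × ℝ → ℝ} {t L : ℝ} (h : ∀ t x, f (t, x + L) = f (t, x)) :
    pt f (t, L) = pt f (t, 0) := by
  have h1 : (fun s => f (s, L)) = fun s => f (s, 0) := funext fun s => by simpa using h s 0
  simp only [pt]
  rw [h1]

lemma val_per {f : ℝ × ℝ → ℝ} {t L : ℝ} (h : ∀ t x, f (t, x + L) = f (t, x)) :
    f (t, L) = f (t, 0) := by simpa using h t 0

lemma core (g lam α β R P ε L T N : ℝ)
    (hg : 0 < g) (hlam : 0 < lam) (hα : 0 < α) (hβ : 0 < β) (hR : 0 < R) (hP : 0 < P)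
    (hε : 0 < ε) (hL : 0 < L) (hN0 : 0 < N)
    (u v w : ℝ × ℝ → ℝ)
    (hu : ContDiffOn ℝ (⊤ : ℕ∞) u (Ico 0 T ×ˢ univ))
    (hv : ContDiffOn ℝ (⊤ : ℕ∞) v (Ico 0 T ×ˢ univ))
    (hw : ContDiffOn ℝ (⊤ : ℕ∞) w (Ico 0 T ×ˢ univ))
    (pu : ∀ t x, u (t, x + L) = u (t, x)) (pv : ∀ t x, v (t, x + L) = v (t, x))
    (pw : ∀ t x, w (t, x + L) = w (t, x))
    (hpos : ∀ t ∈ Ico 0 T, ∀ x, 0 < w (t, x))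
    (hN : ∀ t ∈ Ioo 0 T, ∀ x ∈ Icc 0 L, w (t, x) ^ 2 ≤ N)
    (E1 : ∀ t ∈ Ioo 0 T, ∀ x, pt v (t, x) = (1/2) * px (px u) (t, x)
      - (g * (u (t, x)^2+v (t, x)^2) + lam * w (t, x)^2) * u (t, x)
      + (1/2) * (R * w (t, x)^2 - α) * v (t, x))
    (E2 : ∀ t ∈ Ioo 0 T, ∀ x, pt u (t, x) = -(1/2) * px (px v) (t, x)
      + (g * (u (t, x)^2+v (t, x)^2) + lam * w (t, x)^2) * v (t, x)
      + (1/2) * (R * w (t, x)^2 - α) * u (t, x))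
    (E3 : ∀ t ∈ Ioo 0 T, ∀ x, ε * (2 * w (t, x) * pt w (t, x))
      = P - (R * (u (t, x)^2+v (t, x)^2) + β) * w (t, x)^2)
    {t : ℝ} (ht : t ∈ Ico 0 T) :
    (∫ x in (0:ℝ)..L, Phi g lam β R P ε u v w (t, x)) ≤
      Real.exp ((2 * R * N) * t) * ((∫ x in (0:ℝ)..L, Phi g lam β R P ε u v w (0, x))
        + (2 * R * N * ((lam * P / R) * N) * L) / (2 * R * N))
        - (2 * R * N * ((lam * P / R) * N) * L) / (2 * R * N) := by
  have hsub : (Ioo 0 T ×ˢ univ : Set (ℝ × ℝ)) ⊆ Ico 0 T ×ˢ univ :=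
    prod_mono Ioo_subset_Ico_self (subset_univ _)
  have hPhi : ContDiffOn ℝ (⊤ : ℕ∞) (Phi g lam β R P ε u v w) (Ico 0 T ×ˢ univ) := by
    have h1 := px_contDiffOn hu
    have h2 := px_contDiffOn hv
    have h3 := px_contDiffOn hw
    have h4 : ContDiffOn ℝ (⊤ : ℕ∞) (fun p => Real.log (w p ^ 2)) (Ico 0 T ×ˢ univ) :=
      (hw.pow 2).log (fun p hp => (pow_pos (hpos p.1 hp.1 p.2) 2).ne')
    unfold Phi
    fun_prop
  have hu' := hu.mono hsub
  have hv' := hv.mono hsub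
  have hw' := hw.mono hsub
  have hPhi' := hPhi.mono hsub
  have hux := px_contDiffOn_U hu'
  have hvx := px_contDiffOn_U hv'
  have hwx := px_contDiffOn_U hw'
  have hut := pt_contDiffOn hu'
  have hvt := pt_contDiffOn hv'
  have hwt := pt_contDiffOn hw'
  have hQ : ContDiffOn ℝ (⊤ : ℕ∞) (Qf α R u v w) (Ioo 0 T ×ˢ univ) := by
    unfold Qf
    fun_prop
  refine gron (F := fun t => ∫ x in (0:ℝ)..L, Phi g lam β R P ε u v w (t, x))
    (F' := fun t => ∫ x in (0:ℝ)..L, pt (Phi g lam β R P ε u v w) (t, x)) (by positivity)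
    (slab_int_cont hPhi.continuousOn) (fun t ht => slab_int_deriv hPhi' ht) ?_ ht
  intro t ht
  have hc1 := slab_slice (pt_contDiffOn hPhi').continuousOn ht
  have hc2 := slab_slice (px_contDiffOn_U hQ).continuousOn ht
  have hc3 := slab_slice hPhi'.continuousOn ht
  have hpt : ∀ x ∈ Icc 0 L, pt (Phi g lam β R P ε u v w) (t, x) ≤
      px (Qf α R u v w) (t, x) + 2 * R * N * (Phi g lam β R P ε u v w (t, x) + (lam * P / R) * N) := by
    intro x hx
    have hwp := hpos t (Ioo_subset_Ico_self ht) x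
    have hwN := hN t ht x hx
    have e4 := ((((U_dx hw' (x := x) ht).const_mul 2).mul (U_dx hwt (x := x) ht)).const_mul ε)
    have e4' := ((((((U_dx hu' (x := x) ht).pow 2).add ((U_dx hv' (x := x) ht).pow 2)).const_mul R).add_const β).mul ((U_dx hw' (x := x) ht).pow 2)).const_sub P
    have e5 := (e4.congr_of_eventuallyEq (Filter.Eventually.of_forall fun y => (E3 t ht y).symm)).unique e4'
    have hd1 : pt (Phi g lam β R P ε u v w) (t, x) = _ :=
      ((((((((U_dt hux (x := x) ht).pow 2).add ((U_dt hvx (x := x) ht).pow 2)).const_mul (1/2)).add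
        (((((U_dt hu' (x := x) ht).pow 2).add ((U_dt hv' (x := x) ht).pow 2)).pow 2).const_mul (g/2))).add
        ((((U_dt hw' (x := x) ht).pow 2).const_mul lam).mul
          (((U_dt hu' (x := x) ht).pow 2).add ((U_dt hv' (x := x) ht).pow 2)))).add
        (((U_dt hwx (x := x) ht).pow 2).const_mul (ε/2))).sub
        ((((U_dt hw' (x := x) ht).pow 2).log (pow_pos hwp 2).ne').const_mul (lam * P / R))).add
        (((U_dt hw' (x := x) ht).pow 2).const_mul (β * lam / R)) |>.deriv
    have hd2 : px (Qf α R u v w) (t, x) = _ :=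
      (((U_dx hux (x := x) ht).mul (U_dx hut (x := x) ht)).add
        ((U_dx hvx (x := x) ht).mul (U_dx hvt (x := x) ht))).sub
        ((((((U_dx hw' (x := x) ht).pow 2).const_mul R).sub_const α).const_mul (1/2)).mul
          (((U_dx hux (x := x) ht).mul (U_dx hu' (x := x) ht)).add
          ((U_dx hvx (x := x) ht).mul (U_dx hv' (x := x) ht)))) |>.deriv
    have hA := alg (uxx := px (px u) (t, x)) (vxx := px (px v) (t, x)) (uxt := pt (px u) (t, x))
      (vxt := pt (px v) (t, x)) (wxt := pt (px w) (t, x)) (wx := px w (t, x))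
      (ux := px u (t, x)) (vx := px v (t, x)) (ln := Real.log (w (t, x) ^ 2))
      hg hlam hα hβ hR hP hε hwp hwN
      (by have := Real.log_le_sub_one_of_pos (pow_pos hwp 2); linarith)
      (E1 t ht x) (E2 t ht x) (E3 t ht x) (by
        rw [mixed hw' ht]
        simp at e5
        linarith)
    rw [hd1, hd2]
    simp only [Phi, ← mixed hu' ht, ← mixed hv' ht]
    refine le_trans (le_of_eq ?_) (hA.trans (le_of_eq ?_))
    · simp; ring
    · simp; ring
  have hmono := intervalIntegral.integral_mono_on (μ := MeasureTheory.volume) hL.le (hc1.intervalIntegrable 0 L)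
    (Continuous.intervalIntegrable (by fun_prop) 0 L) hpt
  have hQint : ∫ x in (0:ℝ)..L, px (Qf α R u v w) (t, x) = 0 := by
    rw [intervalIntegral.integral_eq_sub_of_hasDerivAt (f := fun x => Qf α R u v w (t, x))
      (fun x _ => U_dx hQ ht) (hc2.intervalIntegrable _ _)]
    simp only [Qf, px_per (pu t), px_per (pv t), pt_per pu, pt_per pv, val_per pu, val_per pv,
      val_per pw, sub_self]
  rw [intervalIntegral.integral_add (hc2.intervalIntegrable _ _)
    (Continuous.intervalIntegrable (by fun_prop) 0 L), hQint, intervalIntegral.integral_const_mul,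
    intervalIntegral.integral_add (hc3.intervalIntegrable _ _) (by simp)] at hmono
  simp only [intervalIntegral.integral_const, smul_eq_mul, sub_zero] at hmono
  refine hmono.trans (le_of_eq ?_)
  ring

lemma int_split {A B C D : ℝ → ℝ} {a b c L : ℝ} (hA : Continuous A) (hB : Continuous B)
    (hC : Continuous C) (hD : Continuous D) :
    (∫ x in (0:ℝ)..L, A x) + a * (∫ x in (0:ℝ)..L, B x) - b * (∫ x in (0:ℝ)..L, C x)
      + c * (∫ x in (0:ℝ)..L, D x) = ∫ x in (0:ℝ)..L, (A x + a * B x - b * C x + c * D x) := by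
  rw [intervalIntegral.integral_add, intervalIntegral.integral_sub, intervalIntegral.integral_add,
    intervalIntegral.integral_const_mul, intervalIntegral.integral_const_mul,
    intervalIntegral.integral_const_mul]
  all_goals exact Continuous.intervalIntegrable (by fun_prop) 0 L


/-- Proposition 2.7 (energy estimate): for a smooth classical `L`-periodic solution
`(ψ, n)` of the exciton–polariton system on `[0,T)` with `n > 0`, the energy-type
functional `F` satisfies `F(t) ≤ e^{C₁ t} (F(0) + C₂/C₁) - C₂/C₁` for some constants
`C₁ > 0`, `C₂ ≥ 0`. -/
theorem stmt_4 (g lam α β R P ε L T : ℝ)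
    (hg : 0 < g) (hlam : 0 < lam) (hα : 0 < α) (hβ : 0 < β) (hR : 0 < R) (hP : 0 < P)
    (hε : 0 < ε) (hε1 : ε ≤ 1) (hL : 0 < L) (hT : 0 < T)
    (ψ : ℝ → ℝ → ℂ) (n : ℝ → ℝ → ℝ) (ψt : ℝ → ℝ → ℂ) (nt : ℝ → ℝ → ℝ)
    -- smoothness of the solution on `[0,T) × ℝ`
    (hsmooth_ψ : ContDiffOn ℝ (⊤ : ℕ∞) (fun p : ℝ × ℝ => ψ p.1 p.2) (Set.Ico 0 T ×ˢ Set.univ))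
    (hsmooth_n : ContDiffOn ℝ (⊤ : ℕ∞) (fun p : ℝ × ℝ => n p.1 p.2) (Set.Ico 0 T ×ˢ Set.univ))
    -- `L`-periodicity in space
    (hper_ψ : ∀ t x, ψ t (x + L) = ψ t x)
    (hper_n : ∀ t x, n t (x + L) = n t x)
    -- time derivatives
    (hψt : ∀ t ∈ Set.Ico (0:ℝ) T, ∀ x, HasDerivWithinAt (fun s => ψ s x) (ψt t x) (Set.Ico 0 T) t)
    (hnt : ∀ t ∈ Set.Ico (0:ℝ) T, ∀ x, HasDerivWithinAt (fun s => n s x) (nt t x) (Set.Ico 0 T) t)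
    -- positivity of the reservoir density
    (hpos : ∀ t ∈ Set.Ico (0:ℝ) T, ∀ x, 0 < n t x)
    -- the Gross-Pitaevskii equation for the condensate wave function
    (heq1 : ∀ t ∈ Set.Ico (0:ℝ) T, ∀ x,
      Complex.I * ψt t x = -(1/2 : ℂ) * deriv (fun y => deriv (fun z => ψ t z) y) x
        + ((g * ‖ψ t x‖ ^ 2 + lam * n t x : ℝ) : ℂ) * ψ t x
        + (Complex.I / 2) * ((R * n t x - α : ℝ) : ℂ) * ψ t x)
    -- the rate equation for the reservoir density
    (heq2 : ∀ t ∈ Set.Ico (0:ℝ) T, ∀ x,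
      ε * nt t x = P - (R * ‖ψ t x‖ ^ 2 + β) * n t x) :
    -- the energy-type functional
    let F : ℝ → ℝ := fun t =>
      (∫ x in (0:ℝ)..L, ((1/2) * ‖deriv (fun y => ψ t y) x‖ ^ 2
          + (g/2) * ‖ψ t x‖ ^ 4 + lam * n t x * ‖ψ t x‖ ^ 2))
        + (ε/2) * (∫ x in (0:ℝ)..L, (deriv (fun y => Real.sqrt (n t y)) x) ^ 2)
        - (lam * P / R) * (∫ x in (0:ℝ)..L, Real.log (n t x))
        + (β * lam / R) * (∫ x in (0:ℝ)..L, n t x)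
    ∃ C₁ > (0:ℝ), ∃ C₂ ≥ (0:ℝ), ∀ t ∈ Set.Ico (0:ℝ) T,
      F t ≤ Real.exp (C₁ * t) * (F 0 + C₂ / C₁) - C₂ / C₁ := by
  intro F
  set S : Set (ℝ × ℝ) := Ico 0 T ×ˢ univ with hS
  let u : ℝ × ℝ → ℝ := fun p => (ψ p.1 p.2).re
  let v : ℝ × ℝ → ℝ := fun p => (ψ p.1 p.2).im
  let w : ℝ × ℝ → ℝ := fun p => Real.sqrt (n p.1 p.2)
  have hu : ContDiffOn ℝ (⊤ : ℕ∞) u S := Complex.reCLM.contDiff.comp_contDiffOn hsmooth_ψ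
  have hv : ContDiffOn ℝ (⊤ : ℕ∞) v S := Complex.imCLM.contDiff.comp_contDiffOn hsmooth_ψ
  have hw : ContDiffOn ℝ (⊤ : ℕ∞) w S :=
    hsmooth_n.sqrt (fun p hp => (hpos p.1 hp.1 p.2).ne')
  have hw2 : ∀ t ∈ Ico 0 T, ∀ x, w (t, x) ^ 2 = n t x := fun t ht x =>
    Real.sq_sqrt (hpos t ht x).le
  have hρ : ∀ t x, ‖ψ t x‖ ^ 2 = u (t, x) ^ 2 + v (t, x) ^ 2 := fun t x => by
    rw [Complex.sq_norm, Complex.normSq_apply]; ring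
  -- space derivatives of `ψ`
  have hψx : ∀ t ∈ Ico 0 T, ∀ x,
      HasDerivAt (fun y => ψ t y) ((px u (t, x) : ℂ) + (px v (t, x) : ℂ) * Complex.I) x := by
    intro t ht x
    have h := ((px_hasDerivAt hu (x := x) ht).ofReal_comp).add
      (((px_hasDerivAt hv (x := x) ht).ofReal_comp).mul_const Complex.I)
    exact h.congr_of_eventuallyEq
      (Filter.Eventually.of_forall fun y => (Complex.re_add_im (ψ t y)).symm)
  have hψxx : ∀ t ∈ Ico 0 T, ∀ x, deriv (fun y => deriv (fun z => ψ t z) y) x =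
      (px (px u) (t, x) : ℂ) + (px (px v) (t, x) : ℂ) * Complex.I := by
    intro t ht x
    have h := ((px_hasDerivAt (px_contDiffOn hu) (x := x) ht).ofReal_comp).add
      (((px_hasDerivAt (px_contDiffOn hv) (x := x) ht).ofReal_comp).mul_const Complex.I)
    exact (h.congr_of_eventuallyEq
      (Filter.Eventually.of_forall fun y => (hψx t ht y).deriv)).deriv
  have hnψx : ∀ t ∈ Ico 0 T, ∀ x,
      ‖deriv (fun y => ψ t y) x‖ ^ 2 = px u (t, x) ^ 2 + px v (t, x) ^ 2 := by
    intro t ht x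
    rw [(hψx t ht x).deriv, Complex.sq_norm, Complex.normSq_apply]
    simp; ring
  have hsubI : ∀ t ∈ Ioo 0 T, t ∈ Ico 0 T := fun t ht => Ioo_subset_Ico_self ht
  have hnb : ∀ t ∈ Ioo 0 T, Ico 0 T ∈ nhds t := fun t ht =>
    Ico_mem_nhds ht.1 ht.2
  -- time derivatives
  have hut : ∀ t ∈ Ioo 0 T, ∀ x, pt u (t, x) = (ψt t x).re := by
    intro t ht x
    exact (Complex.reCLM.hasFDerivAt.comp_hasDerivAt t
      ((hψt t (hsubI t ht) x).hasDerivAt (hnb t ht))).deriv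
  have hvt : ∀ t ∈ Ioo 0 T, ∀ x, pt v (t, x) = (ψt t x).im := by
    intro t ht x
    exact (Complex.imCLM.hasFDerivAt.comp_hasDerivAt t
      ((hψt t (hsubI t ht) x).hasDerivAt (hnb t ht))).deriv
  have hwt : ∀ t ∈ Ioo 0 T, ∀ x, 2 * w (t, x) * pt w (t, x) = nt t x := by
    intro t ht x
    have h1 : pt w (t, x) = _ := (((hnt t (hsubI t ht) x).hasDerivAt (hnb t ht)).sqrt
      (hpos t (hsubI t ht) x).ne').deriv
    have h2 : 0 < Real.sqrt (n t x) := Real.sqrt_pos.2 (hpos t (hsubI t ht) x)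
    rw [h1]
    simp only [w]
    field_simp
  -- upper bound for `n`
  obtain ⟨N, hN0, hN⟩ : ∃ N > (0:ℝ), ∀ t ∈ Ico 0 T, ∀ x ∈ Icc 0 L, n t x ≤ N := by
    have h0 : (0:ℝ) ∈ Ico 0 T := ⟨le_rfl, hT⟩
    have hc0 : Continuous (fun x => n 0 x) :=
      slab_slice (G := fun p => n p.1 p.2) hsmooth_n.continuousOn h0
    obtain ⟨C, hC⟩ := (isCompact_Icc (a := (0:ℝ)) (b := L)).exists_bound_of_continuousOn
      hc0.continuousOn
    have hC0 : 0 ≤ C := (norm_nonneg _).trans (hC 0 ⟨le_rfl, hL.le⟩)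
    refine ⟨C + P / ε * T, by positivity, fun t ht x hx => ?_⟩
    have hanti : AntitoneOn (fun s => n s x - P / ε * s) (Ico 0 T) := by
      apply antitoneOn_of_deriv_nonpos (convex_Ico 0 T)
      · exact fun s hs => ((hnt s hs x).sub
          ((hasDerivWithinAt_id s _).const_mul (P / ε))).continuousWithinAt
      · rw [interior_Ico]
        exact fun s hs => (((hnt s (hsubI s hs) x).hasDerivAt (hnb s hs)).sub
          ((hasDerivAt_id s).const_mul (P / ε))).differentiableAt.differentiableWithinAt
      · rw [interior_Ico]
        intro s hs
        have h1 : deriv (fun s => n s x - P / ε * s) s = _ :=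
          (((hnt s (hsubI s hs) x).hasDerivAt (hnb s hs)).sub
          ((hasDerivAt_id s).const_mul (P / ε))).deriv
        rw [h1]
        have h2 := heq2 s (hsubI s hs) x
        have h3 := hpos s (hsubI s hs) x
        have h4 : nt s x ≤ P / ε := by
          rw [le_div_iff₀ hε]
          have : 0 ≤ (R * ‖ψ s x‖ ^ 2 + β) * n s x := by positivity
          linarith
        linarith
    have h := hanti h0 ht ht.1
    have h1 := (le_abs_self _).trans (hC x hx)
    have h2 : P / ε * t ≤ P / ε * T := mul_le_mul_of_nonneg_left ht.2.le (by positivity)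
    simp only [mul_zero, sub_zero] at h
    linarith
  -- rewrite `F`
  have hF : ∀ t ∈ Ico 0 T, F t = ∫ x in (0:ℝ)..L, Phi g lam β R P ε u v w (t, x) := by
    intro t ht
    have c1 := slab_slice hu.continuousOn ht
    have c2 := slab_slice hv.continuousOn ht
    have c3 := slab_slice hw.continuousOn ht
    have c4 := slab_slice (px_contDiffOn hu).continuousOn ht
    have c5 := slab_slice (px_contDiffOn hv).continuousOn ht
    have c6 := slab_slice (px_contDiffOn hw).continuousOn ht
    have c7 : Continuous (fun x => Real.log (w (t, x) ^ 2)) :=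
      (c3.pow 2).log (fun x => (pow_pos (Real.sqrt_pos.2 (hpos t ht x)) 2).ne')
    have i1 : ∀ x, (1/2) * ‖deriv (fun y => ψ t y) x‖ ^ 2
          + (g/2) * ‖ψ t x‖ ^ 4 + lam * n t x * ‖ψ t x‖ ^ 2 =
        (1/2) * (px u (t, x) ^ 2 + px v (t, x) ^ 2) + (g/2) * (u (t, x) ^ 2 + v (t, x) ^ 2) ^ 2
          + lam * w (t, x) ^ 2 * (u (t, x) ^ 2 + v (t, x) ^ 2) := by
      intro x
      rw [hnψx t ht x, hw2 t ht x, ← hρ]; ring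
    have i2 : ∀ x, deriv (fun y => Real.sqrt (n t y)) x = px w (t, x) := fun x => rfl
    simp only [F, i1, i2]
    simp only [← hw2 t ht, Phi]
    exact int_split (((continuous_const.mul ((c4.pow 2).add (c5.pow 2))).add
      (continuous_const.mul (((c1.pow 2).add (c2.pow 2)).pow 2))).add
      ((continuous_const.mul (c3.pow 2)).mul ((c1.pow 2).add (c2.pow 2)))) (c6.pow 2) c7 (c3.pow 2)
  -- the equations
  have EQ : ∀ t ∈ Ioo 0 T, ∀ x,
      (pt v (t, x) = (1/2) * px (px u) (t, x)
      - (g * (u (t, x)^2+v (t, x)^2) + lam * w (t, x)^2) * u (t, x)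
      + (1/2) * (R * w (t, x)^2 - α) * v (t, x)) ∧
      (pt u (t, x) = -(1/2) * px (px v) (t, x)
      + (g * (u (t, x)^2+v (t, x)^2) + lam * w (t, x)^2) * v (t, x)
      + (1/2) * (R * w (t, x)^2 - α) * u (t, x)) := by
    intro t ht x
    have h := heq1 t (hsubI t ht) x
    rw [hψxx t (hsubI t ht) x, hρ, ← hw2 t (hsubI t ht) x] at h
    have hI : Complex.I / 2 = ((1/2 : ℝ) : ℂ) * Complex.I := by push_cast; ring
    have hh : -(1/2 : ℂ) = ((-(1/2) : ℝ) : ℂ) := by push_cast; ring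
    rw [hI, hh] at h
    have hr := congrArg Complex.re h
    have hi := congrArg Complex.im h
    simp only [Complex.add_re, Complex.add_im, Complex.mul_re, Complex.mul_im, Complex.ofReal_re,
      Complex.ofReal_im, Complex.I_re, Complex.I_im] at hr hi
    rw [hut t ht, hvt t ht]
    simp only [u, v] at hr hi ⊢
    constructor <;> linarith
  refine ⟨2 * R * N, by positivity, 2 * R * N * ((lam * P / R) * N) * L, by positivity, ?_⟩
  intro t ht
  rw [hF t ht, hF 0 ⟨le_rfl, hT⟩]
  refine core g lam α β R P ε L T N hg hlam hα hβ hR hP hε hL hN0 u v w hu hv hw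
    (fun t x => by simp only [u, hper_ψ]) (fun t x => by simp only [v, hper_ψ])
    (fun t x => by simp only [w, hper_n]) (fun t ht x => Real.sqrt_pos.2 (hpos t ht x))
    (fun t ht x hx => by rw [hw2 t (hsubI t ht) x]; exact hN t (hsubI t ht) x hx)
    (fun t ht x => (EQ t ht x).1) (fun t ht x => (EQ t ht x).2) ?_ ht
  intro t ht x
  rw [hwt t ht x, hw2 t (hsubI t ht) x, heq2 t (hsubI t ht) x, hρ]
end

section
/- Let R, P, α, β > 0 and let ρ₀, n₀ > 0. Then there exists a unique pair of continuously differentiable functions (ρ, n) : [0,∞) → ℝ² satisfying ρ(0) = ρ₀, n(0) = n₀, ρ'(t) = (R·n(t) − α)·ρ(t) and n'(t) = P − (R·ρ(t) + β)·n(t) for all t ≥ 0; moreover this solution satisfies ρ(t) > 0 and n(t) > 0 for all t ≥ 0. -/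
open Set Filter Topology in
lemma ep_global (F : ℝ × ℝ → ℝ × ℝ) (K L : NNReal) (hK : LipschitzWith K F)
    (hL : ∀ x, ‖F x‖ ≤ L) (x₀ : ℝ × ℝ) :
    ∃ x : ℝ → ℝ × ℝ, x 0 = x₀ ∧ ∀ t ∈ Ici (0:ℝ), HasDerivWithinAt x (F (x t)) (Ici 0) t := by
  have h1 : ∀ T : ℝ, ∃ x : ℝ → ℝ × ℝ, 0 ≤ T → x 0 = x₀ ∧
      ∀ t ∈ Icc 0 T, HasDerivWithinAt x (F (x t)) (Icc 0 T) t := by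
    intro T
    by_cases hT : 0 ≤ T
    · have hp : IsPicardLindelof (fun _ => F) (⟨0, le_rfl, hT⟩ : Icc (0:ℝ) T) x₀
          (L * T.toNNReal) 0 L K := by
        apply IsPicardLindelof.of_time_independent
        · exact fun x _ => hL x
        · exact hK.lipschitzOnWith
        · simp [hT]
      obtain ⟨x, hx, hx'⟩ := hp.exists_eq_forall_mem_Icc_hasDerivWithinAt₀
      exact ⟨x, fun _ => ⟨hx, hx'⟩⟩
    · exact ⟨fun _ => 0, fun h => absurd h hT⟩
  choose X hX using h1
  have right : ∀ T t, t ∈ Ico 0 T → HasDerivWithinAt (X T) (F (X T t)) (Ici t) t := by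
    intro T t ht
    have h := (hX T (ht.1.trans ht.2.le)).2 t ⟨ht.1, ht.2.le⟩
    have h2 : HasDerivWithinAt (X T) (F (X T t)) (Icc t T) t :=
      h.mono (Icc_subset_Icc_left ht.1)
    exact h2.mono_of_mem_nhdsWithin (Icc_mem_nhdsGE ht.2)
  have cont : ∀ T, 0 ≤ T → ContinuousOn (X T) (Icc 0 T) := fun T hT t ht =>
    ((hX T hT).2 t ht).continuousWithinAt
  have uniq : ∀ S T, 0 ≤ S → S ≤ T → EqOn (X S) (X T) (Icc 0 S) := by
    intro S T hS hST
    apply ODE_solution_unique (v := fun _ => F) (fun _ => hK) (cont S hS) (right S)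
      ((cont T (hS.trans hST)).mono (Icc_subset_Icc_right hST))
      (fun t ht => right T t ⟨ht.1, ht.2.trans_le hST⟩)
    rw [(hX S hS).1, (hX T (hS.trans hST)).1]
  have uniq2 : ∀ S T s, s ∈ Icc 0 S → s ∈ Icc 0 T → X S s = X T s := by
    intro S T s h1 h2
    rcases le_total S T with h | h
    · exact uniq S T (h1.1.trans h1.2) h h1
    · exact (uniq T S (h2.1.trans h2.2) h h2).symm
  refine ⟨fun t => X (t+1) t, ?_, ?_⟩
  · exact (hX _ (by norm_num)).1
  · intro t ht
    have ht0 : (0:ℝ) ≤ t := ht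
    have h := (hX (t+1) (by linarith)).2 t ⟨ht0, by linarith⟩
    have hm : Icc 0 (t+1) ∈ 𝓝[Ici 0] t := by
      filter_upwards [self_mem_nhdsWithin,
        mem_nhdsWithin_of_mem_nhds (Iio_mem_nhds (lt_add_one t))] with s hs hs'
      exact ⟨hs, le_of_lt hs'⟩
    refine (h.mono_of_mem_nhdsWithin hm).congr_of_eventuallyEq ?_ rfl
    filter_upwards [hm] with s hs
    exact uniq2 _ _ _ ⟨hs.1, by linarith⟩ hs

open Set in
lemma ep_mono (f f' : ℝ → ℝ) (k T : ℝ) (hT : 0 ≤ T) (hf : ContinuousOn f (Icc 0 T))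
    (hd : ∀ t ∈ Ioo 0 T, HasDerivAt f (f' t) t)
    (h : ∀ t ∈ Ioo 0 T, 0 ≤ f' t + k * f t) : f 0 ≤ f T * Real.exp (k * T) := by
  have hm : MonotoneOn (fun t => f t * Real.exp (k * t)) (Icc 0 T) := by
    apply monotoneOn_of_hasDerivWithinAt_nonneg
      (f' := fun t => (f' t + k * f t) * Real.exp (k * t)) (convex_Icc 0 T)
    · exact hf.mul (by fun_prop)
    · intro t ht
      rw [interior_Icc] at ht
      have h1 : HasDerivAt (fun t => Real.exp (k * t)) (Real.exp (k * t) * (k * 1)) t :=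
        ((hasDerivAt_id t).const_mul k).exp
      refine (((hd t ht).mul h1).congr_deriv ?_).hasDerivWithinAt
      ring
    · intro t ht
      rw [interior_Icc] at ht
      exact mul_nonneg (h t ht) (Real.exp_pos _).le
  simpa using hm ⟨le_rfl, hT⟩ ⟨hT, le_rfl⟩ hT

open Set in
lemma ep_good (R P α β ρ₀ n₀ m B : ℝ)
    (hR : 0 < R) (hP : 0 < P) (hα : 0 < α) (hβ : 0 < β)
    (hρ₀ : 0 < ρ₀) (hn₀ : 0 < n₀) (hmα : m ≤ α) (hmβ : m ≤ β)
    (hB : ρ₀ + n₀ ≤ B) (hPB : P ≤ m * B) (ρ n : ℝ → ℝ) (h1 : ρ 0 = ρ₀) (h2 : n 0 = n₀)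
    (hc1 : ContinuousOn ρ (Ici 0)) (hc2 : ContinuousOn n (Ici 0))
    (hd : ∀ t, 0 < t → (0 < ρ t ∧ 0 < n t ∧ ρ t + n t < B + 1) →
      HasDerivAt ρ ((R * n t - α) * ρ t) t ∧ HasDerivAt n (P - (R * ρ t + β) * n t) t) :
    ∀ t, 0 ≤ t → 0 < ρ t ∧ 0 < n t ∧ ρ t + n t < B + 1 := by
  by_contra hcon
  push Not at hcon
  obtain ⟨T, hT, hbad⟩ := hcon
  have hcm : ContinuousOn (fun t => min (min (ρ t) (n t)) (B + 1 - (ρ t + n t))) (Icc 0 T) := by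
    have a1 := hc1.mono (Icc_subset_Ici_self : Icc 0 T ⊆ Ici 0)
    have a2 := hc2.mono (Icc_subset_Ici_self : Icc 0 T ⊆ Ici 0)
    exact ContinuousOn.inf (ContinuousOn.inf a1 a2) (continuousOn_const.sub (a1.add a2))
  have hcl := hcm.preimage_isClosed_of_isClosed isClosed_Icc (isClosed_Iic (a := (0:ℝ)))
  have hco := isCompact_Icc.of_isClosed_subset hcl inter_subset_left
  have hne : (Icc 0 T ∩ (fun t => min (min (ρ t) (n t)) (B + 1 - (ρ t + n t))) ⁻¹' Iic 0).Nonempty := by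
    refine ⟨T, ⟨hT, le_rfl⟩, ?_⟩
    by_contra h
    simp only [mem_preimage, mem_Iic, not_le, lt_min_iff] at h
    have := hbad h.1.1 h.1.2
    linarith [h.2]
  obtain ⟨s, ⟨hs, hs'⟩, hmin⟩ := hco.exists_isLeast hne
  have hg : ∀ t ∈ Ioo 0 s, 0 < ρ t ∧ 0 < n t ∧ ρ t + n t < B + 1 := by
    intro t ht
    by_contra h
    have : s ≤ t := hmin ⟨⟨ht.1.le, ht.2.le.trans hs.2⟩, by
      simp only [mem_preimage, mem_Iic]
      by_contra h'
      simp only [not_le, lt_min_iff] at h'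
      exact h ⟨h'.1.1, h'.1.2, by linarith [h'.2]⟩⟩
    linarith [ht.2]
  have a1 := hc1.mono (Icc_subset_Ici_self : Icc 0 s ⊆ Ici 0)
  have a2 := hc2.mono (Icc_subset_Ici_self : Icc 0 s ⊆ Ici 0)
  have e1 := ep_mono ρ _ α s hs.1 a1 (fun t ht => (hd t ht.1 (hg t ht)).1) (by
    intro t ht
    obtain ⟨b1, b2, b3⟩ := hg t ht
    have : 0 < R * n t * ρ t := by positivity
    linarith)
  have e2 := ep_mono n _ (R * (B + 1) + β) s hs.1 a2 (fun t ht => (hd t ht.1 (hg t ht)).2) (by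
    intro t ht
    obtain ⟨b1, b2, b3⟩ := hg t ht
    have : 0 < R * n t * (B + 1 - ρ t) := by
      have : 0 < B + 1 - ρ t := by linarith
      positivity
    linarith)
  have e3 := ep_mono (fun t => B - (ρ t + n t)) _ m s hs.1 (continuousOn_const.sub (a1.add a2))
    (fun t ht => ((hd t ht.1 (hg t ht)).1.add (hd t ht.1 (hg t ht)).2).const_sub B) (by
    intro t ht
    obtain ⟨b1, b2, b3⟩ := hg t ht
    have c1 : 0 ≤ (α - m) * ρ t := mul_nonneg (by linarith) b1.le
    have c2 : 0 ≤ (β - m) * n t := mul_nonneg (by linarith) b2.le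
    linarith)
  have f1 : 0 < ρ s := pos_of_mul_pos_left (by linarith) (Real.exp_pos (α * s)).le
  have f2 : 0 < n s := pos_of_mul_pos_left (by linarith) (Real.exp_pos ((R * (B + 1) + β) * s)).le
  have f3 : 0 ≤ B - (ρ s + n s) :=
    nonneg_of_mul_nonneg_left (le_trans (by simp only [h1, h2]; linarith) e3) (Real.exp_pos (m * s))
  simp only [mem_preimage, mem_Iic] at hs'
  have : 0 < min (min (ρ s) (n s)) (B + 1 - (ρ s + n s)) :=
    lt_min (lt_min f1 f2) (by linarith)
  linarith

/-- The polynomial vector field. -/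
def epG (R P α β : ℝ) (x : ℝ × ℝ) : ℝ × ℝ :=
  ((R * x.2 - α) * x.1, P - (R * x.1 + β) * x.2)

/-- The clamp onto the square. -/
def epC (M : ℝ) (x : ℝ × ℝ) : ℝ × ℝ := (max 0 (min M x.1), max 0 (min M x.2))

open Set in
lemma ep_trunc (R P α β M : ℝ) (hM : 0 ≤ M) : ∃ K L : NNReal,
    LipschitzWith K (fun x => epG R P α β (epC M x)) ∧ ∀ x, ‖epG R P α β (epC M x)‖ ≤ L := by
  have hG : ContDiff ℝ 1 (epG R P α β) := by unfold epG; fun_prop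
  have hS : IsCompact (Icc (0:ℝ) M ×ˢ Icc (0:ℝ) M) := isCompact_Icc.prod isCompact_Icc
  have hmap : ∀ x, epC M x ∈ Icc (0:ℝ) M ×ˢ Icc (0:ℝ) M := by
    intro x
    refine ⟨⟨?_, ?_⟩, ⟨?_, ?_⟩⟩ <;> simp [epC, hM]
  obtain ⟨K, hK⟩ := hG.locallyLipschitz.locallyLipschitzOn.exists_lipschitzOnWith_of_compact hS
  obtain ⟨L, hL⟩ := hS.exists_bound_of_continuousOn hG.continuous.continuousOn
  have hC : LipschitzWith (max 1 1) (epC M) :=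
    ((LipschitzWith.prod_fst.const_min M).const_max 0).prodMk
      ((LipschitzWith.prod_snd.const_min M).const_max 0)
  refine ⟨K * max 1 1, L.toNNReal, ?_, fun x => (hL _ (hmap x)).trans (Real.le_coe_toNNReal L)⟩
  rw [← lipschitzOnWith_univ] at hC ⊢
  exact hK.comp hC (fun x _ => hmap x)


/-- Lemma 3.1: global existence, uniqueness and positivity for the spatially
homogeneous exciton–polariton ODE system `ρ' = (Rn - α)ρ`, `n' = P - (Rρ + β)n`
on `[0,∞)` with positive initial data. -/
theorem stmt_5 (R P α β ρ₀ n₀ : ℝ)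
    (hR : 0 < R) (hP : 0 < P) (hα : 0 < α) (hβ : 0 < β)
    (hρ₀ : 0 < ρ₀) (hn₀ : 0 < n₀) :
    ∃ ρ n : ℝ → ℝ,
      (ρ 0 = ρ₀ ∧ n 0 = n₀ ∧
        (∀ t ∈ Set.Ici (0:ℝ),
          HasDerivWithinAt ρ ((R * n t - α) * ρ t) (Set.Ici 0) t ∧
          HasDerivWithinAt n (P - (R * ρ t + β) * n t) (Set.Ici 0) t) ∧
        (∀ t ∈ Set.Ici (0:ℝ), 0 < ρ t ∧ 0 < n t)) ∧
      (∀ ρ' n' : ℝ → ℝ, ρ' 0 = ρ₀ → n' 0 = n₀ →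
        (∀ t ∈ Set.Ici (0:ℝ),
          HasDerivWithinAt ρ' ((R * n' t - α) * ρ' t) (Set.Ici 0) t ∧
          HasDerivWithinAt n' (P - (R * ρ' t + β) * n' t) (Set.Ici 0) t) →
        ∀ t ∈ Set.Ici (0:ℝ), ρ' t = ρ t ∧ n' t = n t) := by
  set m := min α β with hm
  have hm0 : 0 < m := lt_min hα hβ
  set B := max (ρ₀ + n₀) (P / m) with hBdef
  have hB : ρ₀ + n₀ ≤ B := le_max_left _ _
  have hPB : P ≤ m * B := by
    have : P / m ≤ B := le_max_right _ _
    rw [div_le_iff₀ hm0] at this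
    linarith
  obtain ⟨K, L, hK, hL⟩ := ep_trunc R P α β (B + 1) (by linarith)
  have hclamp : ∀ a b : ℝ, (0 < a ∧ 0 < b ∧ a + b < B + 1) → epC (B + 1) (a, b) = (a, b) := by
    rintro a b ⟨h1, h2, h3⟩
    have e1 : min (B + 1) a = a := min_eq_right (by linarith)
    have e2 : min (B + 1) b = b := min_eq_right (by linarith)
    simp only [epC, e1, e2, max_eq_right h1.le, max_eq_right h2.le]
  have good := ep_good R P α β ρ₀ n₀ m B hR hP hα hβ hρ₀ hn₀ (min_le_left _ _) (min_le_right _ _)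
    hB hPB
  obtain ⟨x, hx0, hx⟩ := ep_global _ K L hK hL (ρ₀, n₀)
  have hxc : ContinuousOn x (Set.Ici 0) := fun t ht => (hx t ht).continuousWithinAt
  have hd1 : ∀ t ∈ Set.Ici (0:ℝ), (0 < (x t).1 ∧ 0 < (x t).2 ∧ (x t).1 + (x t).2 < B + 1) →
      HasDerivWithinAt (fun t => (x t).1) ((R * (x t).2 - α) * (x t).1) (Set.Ici 0) t ∧
      HasDerivWithinAt (fun t => (x t).2) (P - (R * (x t).1 + β) * (x t).2) (Set.Ici 0) t := by
    intro t ht hg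
    have h := hx t ht
    have hc := hclamp _ _ hg
    rw [Prod.mk.eta] at hc
    simp only [hc] at h
    exact ⟨h.fst, h.snd⟩
  have hg := good (fun t => (x t).1) (fun t => (x t).2) (by simp [hx0]) (by simp [hx0])
    hxc.fst hxc.snd (fun t ht hg =>
      ⟨(hd1 t ht.le hg).1.hasDerivAt (Ici_mem_nhds ht),
        (hd1 t ht.le hg).2.hasDerivAt (Ici_mem_nhds ht)⟩)
  refine ⟨fun t => (x t).1, fun t => (x t).2, ⟨by simp [hx0], by simp [hx0],
    fun t ht => hd1 t ht (hg t ht), fun t ht => ⟨(hg t ht).1, (hg t ht).2.1⟩⟩, ?_⟩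
  intro ρ' n' h1 h2 hd t ht
  have hg' := good ρ' n' h1 h2 (fun t ht => (hd t ht).1.continuousWithinAt)
    (fun t ht => (hd t ht).2.continuousWithinAt) (fun t ht _ =>
      ⟨(hd t ht.le).1.hasDerivAt (Ici_mem_nhds ht), (hd t ht.le).2.hasDerivAt (Ici_mem_nhds ht)⟩)
  have hy : ∀ t ∈ Set.Ici (0:ℝ), HasDerivWithinAt (fun t => (ρ' t, n' t))
      (epG R P α β (epC (B + 1) (ρ' t, n' t))) (Set.Ici 0) t := by
    intro t ht
    rw [hclamp _ _ (hg' t ht)]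
    exact (hd t ht).1.prodMk (hd t ht).2
  have key := ODE_solution_unique (v := fun _ x => epG R P α β (epC (B + 1) x))
    (f := fun t => (ρ' t, n' t)) (g := x) (a := 0) (b := t) (fun _ => hK)
    (fun s hs => ((hy s hs.1).continuousWithinAt).mono Set.Icc_subset_Ici_self)
    (fun s hs => (hy s hs.1).mono (Set.Ici_subset_Ici.2 hs.1))
    (hxc.mono Set.Icc_subset_Ici_self)
    (fun s hs => (hx s hs.1).mono (Set.Ici_subset_Ici.2 hs.1))
    (by simp [h1, h2, hx0])
  have := key ⟨ht, le_rfl⟩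
  simp only [Prod.ext_iff] at this
  exact this
end

section
/- Let R, P, α, β > 0 and suppose (ρ, n) : [0,T) → ℝ² is continuously differentiable with ρ(t) > 0 and n(t) > 0 for all t ∈ [0,T), and satisfies ρ'(t) = (R·n(t) − α)·ρ(t) and n'(t) = P − (R·ρ(t) + β)·n(t) on [0,T). Then for all t ∈ [0,T) one has n(t) ≤ P·t + n(0) and ρ(t) ≤ ρ(0)·exp( R·P·t²/2 + t·(R·n(0) − α) ). -/
theorem aux_le (T : ℝ) (f f' : ℝ → ℝ)
    (hf : ∀ t ∈ Set.Ico (0:ℝ) T, HasDerivWithinAt f (f' t) (Set.Ico 0 T) t)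
    (h0 : ∀ t ∈ Set.Ico (0:ℝ) T, f' t ≤ 0) (t : ℝ) (ht : t ∈ Set.Ico (0:ℝ) T) :
    f t ≤ f 0 :=
  antitoneOn_of_hasDerivWithinAt_nonpos (convex_Ico 0 T)
    (fun x hx => (hf x hx).continuousWithinAt)
    (fun x hx => (hf x (interior_subset hx)).mono interior_subset)
    (fun x hx => h0 x (interior_subset hx))
    (Set.mem_Ico.2 ⟨le_rfl, ht.1.trans_lt ht.2⟩) ht ht.1

/-- The a-priori growth bounds from the proof of Lemma 3.1: for a positive solution of
`ρ' = (Rn - α)ρ`, `n' = P - (Rρ + β)n` on `[0,T)` one has `n(t) ≤ P t + n(0)` and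
`ρ(t) ≤ ρ(0) exp(R P t²/2 + t (R n(0) - α))`. -/
theorem stmt_6 (R P α β T : ℝ)
    (hR : 0 < R) (hP : 0 < P) (hα : 0 < α) (hβ : 0 < β)
    (ρ n : ℝ → ℝ)
    (hpos : ∀ t ∈ Set.Ico (0:ℝ) T, 0 < ρ t ∧ 0 < n t)
    (hode : ∀ t ∈ Set.Ico (0:ℝ) T,
      HasDerivWithinAt ρ ((R * n t - α) * ρ t) (Set.Ico 0 T) t ∧
      HasDerivWithinAt n (P - (R * ρ t + β) * n t) (Set.Ico 0 T) t) :
    ∀ t ∈ Set.Ico (0:ℝ) T,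
      n t ≤ P * t + n 0 ∧
      ρ t ≤ ρ 0 * Real.exp (R * P * t ^ 2 / 2 + t * (R * n 0 - α)) := by
  have hn : ∀ t ∈ Set.Ico (0:ℝ) T, n t ≤ P * t + n 0 := by
    intro t ht
    have := aux_le T (fun t => n t - P * t) (fun t => (P - (R * ρ t + β) * n t) - P * 1)
      (fun t ht => (hode t ht).2.sub ((hasDerivWithinAt_id t _).const_mul P))
      (fun t ht => by
        obtain ⟨h1, h2⟩ := hpos t ht
        have : 0 < (R * ρ t + β) * n t := by positivity
        linarith) t ht
    simp only [mul_zero] at this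
    linarith
  intro t ht
  refine ⟨hn t ht, ?_⟩
  have h0 : (0:ℝ) ∈ Set.Ico (0:ℝ) T := ⟨le_rfl, ht.1.trans_lt ht.2⟩
  have key := aux_le T
    (fun t => Real.log (ρ t) - (R * P * t ^ 2 / 2 + t * (R * n 0 - α)))
    (fun t => (R * n t - α) - (R * P * t + (R * n 0 - α)))
    (fun t ht => by
      have hp := (hpos t ht).1
      have h1 := (hode t ht).1.log hp.ne'
      rw [mul_div_cancel_right₀ _ hp.ne'] at h1
      have h2 : HasDerivAt (fun t : ℝ => R * P * t ^ 2 / 2 + t * (R * n 0 - α))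
          (R * P * t + (R * n 0 - α)) t := by
        have := (((hasDerivAt_pow 2 t).const_mul (R * P)).div_const 2).add
          ((hasDerivAt_id t).mul_const (R * n 0 - α))
        refine this.congr_deriv ?_
        norm_num
        ring
      exact h1.sub h2.hasDerivWithinAt)
    (fun t ht => by
      have := mul_le_mul_of_nonneg_left (hn t ht) hR.le
      linarith) t ht
  have hp := (hpos t ht).1
  have hp0 := (hpos 0 h0).1
  rw [← Real.log_le_log_iff hp (by positivity), Real.log_mul hp0.ne' (Real.exp_ne_zero _),
    Real.log_exp]
  norm_num at key
  linarith
end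

section
/- Let R, P, α, β > 0 with PR − αβ ≠ 0. Then every complex eigenvalue of the matrix J₁ has nonzero real part, and every complex eigenvalue of the matrix J₂ has nonzero real part; that is, both equilibria ξ₁ and ξ₂ are hyperbolic. -/
/-- Theorem 3.3 (i): if `PR - αβ ≠ 0`, every eigenvalue of the Jacobians `J₁` (at `ξ₁`)
and `J₂` (at `ξ₂`) has nonzero real part, i.e. both equilibria are hyperbolic. -/
theorem stmt_12 (R P α β : ℝ)
    (hR : 0 < R) (hP : 0 < P) (hα : 0 < α) (hβ : 0 < β)
    (h : P * R - α * β ≠ 0) :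
    let J₁ : Matrix (Fin 2) (Fin 2) ℂ :=
      !![0, (((P * R - α * β) / α : ℝ) : ℂ); ((-α : ℝ) : ℂ), ((-(P * R) / α : ℝ) : ℂ)]
    let J₂ : Matrix (Fin 2) (Fin 2) ℂ :=
      !![((P * R / β - α : ℝ) : ℂ), 0; ((-(P * R) / β : ℝ) : ℂ), ((-β : ℝ) : ℂ)]
    (∀ lam : ℂ, Matrix.det (J₁ - lam • (1 : Matrix (Fin 2) (Fin 2) ℂ)) = 0 → lam.re ≠ 0) ∧
    (∀ lam : ℂ, Matrix.det (J₂ - lam • (1 : Matrix (Fin 2) (Fin 2) ℂ)) = 0 → lam.re ≠ 0) := by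
  intro J₁ J₂
  constructor
  · intro lam hdet hre
    have hb : (P * R - α * β) / α ≠ 0 := div_ne_zero h hα.ne'
    have ha : -(P * R) / α ≠ 0 := div_ne_zero (neg_ne_zero.mpr (mul_pos hP hR).ne') hα.ne'
    simp only [J₁] at hdet
    generalize (P * R - α * β) / α = b at hb hdet
    generalize -(P * R) / α = a at ha hdet
    have e : (0 - lam) * ((a : ℂ) - lam) - (b : ℂ) * ((-α : ℝ) : ℂ) = 0 := by
      refine Eq.trans ?_ hdet
      rw [Matrix.det_fin_two]
      simp
    have e1 := congrArg Complex.re e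
    have e2 := congrArg Complex.im e
    simp [hre] at e1 e2
    have hy : lam.im = 0 := by
      rcases e2 with h1 | h1
      · exact h1
      · exact absurd h1 ha
    rw [hy] at e1
    have : b * α = 0 := by linarith
    exact (mul_ne_zero hb hα.ne') this
  · intro lam hdet hre
    have hc : P * R / β - α ≠ 0 := by
      intro hc
      apply h
      field_simp at hc
      linarith
    simp only [J₂] at hdet
    generalize P * R / β - α = c at hc hdet
    have e : ((c : ℂ) - lam) * (((-β : ℝ) : ℂ) - lam) = 0 := by
      refine Eq.trans ?_ hdet
      rw [Matrix.det_fin_two]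
      simp
    rcases mul_eq_zero.mp e with e | e
    · have e1 := congrArg Complex.re e
      simp [hre] at e1
      exact hc e1
    · have e1 := congrArg Complex.re e
      simp [hre] at e1
      exact hβ.ne' e1
end

section
/- Let α, β, P, R > 0 with β > α and PR − αβ > 0. Then (PR)² − 4α²·(PR) + 4α³·β > 0, and consequently both complex eigenvalues of the matrix J₁ are real, distinct, and strictly negative. -/
/-- Corollary 3.4: if `β > α` and `PR - αβ > 0`, then
`(PR)² - 4α²(PR) + 4α³β > 0`, and both eigenvalues of the Jacobian `J₁` at `ξ₁` are
real, distinct and strictly negative (so `ξ₁` is an asymptotically stable node). -/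
theorem stmt_13 (R P α β : ℝ)
    (hR : 0 < R) (hP : 0 < P) (hα : 0 < α) (hβ : 0 < β)
    (hβα : α < β) (h : 0 < P * R - α * β) :
    let J₁ : Matrix (Fin 2) (Fin 2) ℂ :=
      !![0, (((P * R - α * β) / α : ℝ) : ℂ); ((-α : ℝ) : ℂ), ((-(P * R) / α : ℝ) : ℂ)]
    (0 < (P * R) ^ 2 - 4 * α ^ 2 * (P * R) + 4 * α ^ 3 * β) ∧
    ∃ lam₁ lam₂ : ℝ, lam₁ ≠ lam₂ ∧ lam₁ < 0 ∧ lam₂ < 0 ∧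
      ∀ lam : ℂ, Matrix.det (J₁ - lam • (1 : Matrix (Fin 2) (Fin 2) ℂ)) = 0 ↔
        lam = (lam₁ : ℂ) ∨ lam = (lam₂ : ℂ) := by
  intro J₁
  have hD : 0 < (P * R) ^ 2 - 4 * α ^ 2 * (P * R) + 4 * α ^ 3 * β := by
    have h1 : 0 < α ^ 3 * (β - α) := mul_pos (by positivity) (by linarith)
    nlinarith [sq_nonneg (P * R - 2 * α ^ 2)]
  refine ⟨hD, ?_⟩
  obtain ⟨s, hs, hss⟩ : ∃ s : ℝ, 0 < s ∧
      s ^ 2 = (P * R) ^ 2 - 4 * α ^ 2 * (P * R) + 4 * α ^ 3 * β :=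
    ⟨_, Real.sqrt_pos.mpr hD, Real.sq_sqrt hD.le⟩
  have hx : 0 < P * R := mul_pos hP hR
  have hsx : s < P * R := by
    have h2 : 0 < α ^ 2 * (P * R - α * β) := mul_pos (by positivity) h
    nlinarith
  refine ⟨(-(P * R) - s) / (2 * α), (-(P * R) + s) / (2 * α), ?_, ?_, ?_, ?_⟩
  · apply ne_of_lt
    apply div_lt_div_of_pos_right _ (by positivity)
    linarith
  · exact div_neg_of_neg_of_pos (by linarith) (by positivity)
  · exact div_neg_of_neg_of_pos (by linarith) (by positivity)
  · intro lam
    have hαc : (α : ℂ) ≠ 0 := by exact_mod_cast hα.ne'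
    have hssc : (s : ℂ) ^ 2 = ((P : ℂ) * R) ^ 2 - 4 * α ^ 2 * (P * R) + 4 * α ^ 3 * β := by
      exact_mod_cast hss
    have key : Matrix.det (J₁ - lam • (1 : Matrix (Fin 2) (Fin 2) ℂ)) =
        (lam - (((-(P * R) - s) / (2 * α) : ℝ) : ℂ)) *
        (lam - (((-(P * R) + s) / (2 * α) : ℝ) : ℂ)) := by
      simp only [J₁, Matrix.det_fin_two]
      simp
      field_simp
      linear_combination hssc
    rw [key, mul_eq_zero, sub_eq_zero, sub_eq_zero]
end

section
/- Let R, P, α, β > 0 with PR − αβ < 0, and let (ρ, n) : [0,∞) → ℝ² be continuously differentiable with ρ(t) ≥ 0 for all t ≥ 0, satisfying ρ'(t) = (R·n(t) − α)·ρ(t) and n'(t) = P − (R·ρ(t) + β)·n(t). Define ℓ(t) = (P/β)·ρ(t) + (1/2)·(n(t) − P/β)². Then there exists c > 0 such that ℓ'(t) ≤ −c·ℓ(t) for all t ≥ 0, hence ℓ(t) ≤ e^{−ct}·ℓ(0) for all t ≥ 0; in particular ρ(t) → 0 and n(t) → P/β exponentially fast as t → +∞. -/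
/-- Lemma 3.5: if `PR - αβ < 0`, then `ℓ(t) = (P/β) ρ(t) + (1/2)(n(t) - P/β)²` is a
Lyapunov functional for the homogeneous system: `ℓ' ≤ -c ℓ` for some `c > 0`, hence
`ℓ(t) ≤ e^{-ct} ℓ(0)`; in particular `ρ(t) → 0` and `n(t) → P/β` as `t → ∞`. -/
theorem stmt_14 (R P α β : ℝ)
    (hR : 0 < R) (hP : 0 < P) (hα : 0 < α) (hβ : 0 < β)
    (h : P * R - α * β < 0)
    (ρ n : ℝ → ℝ)
    (hρ_nonneg : ∀ t ∈ Set.Ici (0:ℝ), 0 ≤ ρ t)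
    (hode : ∀ t ∈ Set.Ici (0:ℝ),
      HasDerivWithinAt ρ ((R * n t - α) * ρ t) (Set.Ici 0) t ∧
      HasDerivWithinAt n (P - (R * ρ t + β) * n t) (Set.Ici 0) t) :
    let ℓ : ℝ → ℝ := fun t => (P / β) * ρ t + (1/2) * (n t - P / β) ^ 2
    ∃ c > (0:ℝ),
      (∀ t ∈ Set.Ici (0:ℝ),
        HasDerivWithinAt ℓ
          ((P / β) * ((R * n t - α) * ρ t) + (n t - P / β) * (P - (R * ρ t + β) * n t))
          (Set.Ici 0) t ∧
        (P / β) * ((R * n t - α) * ρ t) + (n t - P / β) * (P - (R * ρ t + β) * n t)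
          ≤ -c * ℓ t) ∧
      (∀ t ∈ Set.Ici (0:ℝ), ℓ t ≤ Real.exp (-c * t) * ℓ 0) ∧
      Filter.Tendsto ρ Filter.atTop (nhds 0) ∧
      Filter.Tendsto n Filter.atTop (nhds (P / β)) := by
  intro ℓ
  obtain ⟨k, hk⟩ : ∃ k, k = P / β := ⟨_, rfl⟩
  have hPk : P = β * k := by rw [hk]; field_simp
  have hk0 : 0 < k := by rw [hk]; positivity
  have hd : 0 < α - R * k := by
    have : 0 < β * (α - R * k) := by rw [hPk] at h; nlinarith
    exact (mul_pos_iff_of_pos_left hβ).1 this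
  have hℓ : ∀ t, ℓ t = k * ρ t + (1/2) * (n t - k) ^ 2 := by
    intro t; simp only [ℓ, hk]
  set c := min (α - R * k) (2 * β) with hc
  have hc0 : 0 < c := lt_min hd (by positivity)
  have hc1 : c ≤ α - R * k := min_le_left _ _
  have hc2 : c ≤ 2 * β := min_le_right _ _
  have key : ∀ t ∈ Set.Ici (0:ℝ),
        HasDerivWithinAt ℓ
          ((P / β) * ((R * n t - α) * ρ t) + (n t - P / β) * (P - (R * ρ t + β) * n t))
          (Set.Ici 0) t ∧
        (P / β) * ((R * n t - α) * ρ t) + (n t - P / β) * (P - (R * ρ t + β) * n t)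
          ≤ -c * ℓ t := by
    intro t ht
    obtain ⟨h1, h2⟩ := hode t ht
    refine ⟨?_, ?_⟩
    · have := (h1.const_mul (P / β)).add (((h2.sub_const (P / β)).pow 2).const_mul (1/2))
      refine this.congr_deriv ?_
      norm_num
      ring
    · rw [← hk, hℓ, hPk]
      have h0 := hρ_nonneg t ht
      have e1 : 0 ≤ (α - R * k - c) * (k * ρ t) :=
        mul_nonneg (by linarith) (by positivity)
      have e2 : 0 ≤ (2 * β - c) * (n t - k) ^ 2 :=
        mul_nonneg (by linarith) (by positivity)
      have e3 : 0 ≤ R * ρ t * (n t - k) ^ 2 := by positivity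
      nlinarith
  have decay : ∀ t ∈ Set.Ici (0:ℝ), ℓ t ≤ Real.exp (-c * t) * ℓ 0 := by
    have hder : ∀ t ∈ Set.Ici (0:ℝ), HasDerivWithinAt (fun t => Real.exp (c * t) * ℓ t) 
        (Real.exp (c * t) * (c * ℓ t + ((P / β) * ((R * n t - α) * ρ t) +
          (n t - P / β) * (P - (R * ρ t + β) * n t)))) (Set.Ici 0) t := by
      intro t ht
      have he : HasDerivAt (fun t => Real.exp (c * t)) (Real.exp (c * t) * (c * 1)) t :=
        ((hasDerivAt_id t).const_mul c).exp
      refine (he.hasDerivWithinAt.mul (key t ht).1).congr_deriv ?_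
      ring
    have hanti : AntitoneOn (fun t => Real.exp (c * t) * ℓ t) (Set.Ici 0) := by
      refine antitoneOn_of_hasDerivWithinAt_nonpos (convex_Ici 0)
        (fun t ht => (hder t ht).continuousWithinAt)
        (fun t ht => (hder t (interior_subset ht)).mono interior_subset) ?_
      intro t ht
      have := (key t (interior_subset ht)).2
      exact mul_nonpos_of_nonneg_of_nonpos (Real.exp_pos _).le (by linarith)
    intro t ht
    have h1 := hanti (Set.mem_Ici.2 le_rfl) ht ht
    simp only [mul_zero, Real.exp_zero, one_mul] at h1
    calc ℓ t = Real.exp (-c * t) * (Real.exp (c * t) * ℓ t) := by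
          rw [← mul_assoc, ← Real.exp_add]; simp
      _ ≤ _ := mul_le_mul_of_nonneg_left h1 (Real.exp_pos _).le
  have hexp : Filter.Tendsto (fun t => Real.exp (-c * t) * ℓ 0) Filter.atTop (nhds 0) := by
    have : Filter.Tendsto (fun t => Real.exp (-c * t)) Filter.atTop (nhds 0) :=
      Real.tendsto_exp_atBot.comp
        (Filter.tendsto_id.const_mul_atTop_of_neg (by linarith))
    simpa using this.mul_const (ℓ 0)
  refine ⟨c, hc0, key, decay, ?_, ?_⟩
  · have h2 : Filter.Tendsto (fun t => k⁻¹ * (Real.exp (-c * t) * ℓ 0)) Filter.atTop (nhds 0) := by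
      simpa using hexp.const_mul k⁻¹
    refine tendsto_of_tendsto_of_tendsto_of_le_of_le' tendsto_const_nhds h2 ?_ ?_
    · filter_upwards [Filter.eventually_ge_atTop 0] with t ht using hρ_nonneg t ht
    · filter_upwards [Filter.eventually_ge_atTop 0] with t ht
      have := decay t ht
      rw [hℓ t] at this
      rw [le_inv_mul_iff₀ hk0]
      nlinarith [sq_nonneg (n t - k)]
  · rw [← hk]
    have h2 : Filter.Tendsto (fun t => (n t - k) ^ 2) Filter.atTop (nhds 0) := by
      have h3 : Filter.Tendsto (fun t => 2 * (Real.exp (-c * t) * ℓ 0)) Filter.atTop (nhds 0) := by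
        simpa using hexp.const_mul 2
      refine tendsto_of_tendsto_of_tendsto_of_le_of_le' tendsto_const_nhds h3 ?_ ?_
      · exact Filter.Eventually.of_forall fun t => sq_nonneg _
      · filter_upwards [Filter.eventually_ge_atTop 0] with t ht
        have := decay t ht
        rw [hℓ t] at this
        have := mul_nonneg hk0.le (hρ_nonneg t ht)
        linarith
    have h4 := h2.sqrt
    simp only [Real.sqrt_sq_eq_abs, Real.sqrt_zero] at h4
    have h5 := (tendsto_zero_iff_abs_tendsto_zero _).2 h4
    simpa using h5.add_const k
end

section
/- Let g, λ, α, β, R, P > 0 and L > 0. Let μ ∈ ℝ and let φ : ℝ → ℂ be a twice continuously differentiable L-periodic function satisfying pointwise μ·φ = −(1/2)·φ'' + g·|φ|²·φ + λP·φ/(β + R|φ|²) + (i/2)·( PR/(β + R|φ|²) − α )·φ. If φ is not identically zero, then PR − αβ > 0 and μ > 0. -/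
theorem aux_periodic (F f : ℝ → ℝ) (L : ℝ) (hL : 0 < L) (hper : ∀ x, F (x + L) = F x)
    (hd : ∀ x, HasDerivAt F (f x) x) (hf : ∀ x, 0 ≤ f x) (x : ℝ) : f x = 0 := by
  have hmono : Monotone F := monotone_of_deriv_nonneg (fun x => (hd x).differentiableAt)
    (fun x => by rw [(hd x).deriv]; exact hf x)
  have hn : ∀ (n : ℕ) (x : ℝ), F (x + n * L) = F x := by
    intro n
    induction n with
    | zero => intro x; simp
    | succ k ih =>
      intro x
      have := hper (x + k * L)
      rw [ih x] at this
      rw [← this]; congr 1; push_cast; ring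
  have hle : ∀ a b : ℝ, F a ≤ F b := by
    intro a b
    obtain ⟨n, hn'⟩ := exists_nat_ge ((a - b) / L)
    rw [div_le_iff₀ hL] at hn'
    rw [← hn n b]
    exact hmono (by linarith)
  have hc : F = fun _ => F 0 := funext fun a => le_antisymm (hle _ _) (hle _ _)
  have h1 := hd x
  rw [hc] at h1
  exact h1.unique (hasDerivAt_const x (F 0))

/-- Lemma 4.1: a necessary condition for the existence of a nontrivial `L`-periodic
`C²` steady state `φ` of the exciton–polariton system (with chemical potential `μ`)
is `PR - αβ > 0` and `μ > 0`. -/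
theorem stmt_15 (g lam α β R P L μ : ℝ)
    (hg : 0 < g) (hlam : 0 < lam) (hα : 0 < α) (hβ : 0 < β) (hR : 0 < R) (hP : 0 < P)
    (hL : 0 < L)
    (φ : ℝ → ℂ)
    (hsmooth : ContDiff ℝ 2 φ)
    (hper : ∀ x, φ (x + L) = φ x)
    (heq : ∀ x : ℝ,
      (μ : ℂ) * φ x = -(1/2 : ℂ) * deriv (deriv φ) x
        + ((g * ‖φ x‖ ^ 2 : ℝ) : ℂ) * φ x
        + ((lam * P : ℝ) : ℂ) * φ x / ((β + R * ‖φ x‖ ^ 2 : ℝ) : ℂ)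
        + (Complex.I / 2)
          * (((P * R : ℝ) : ℂ) / ((β + R * ‖φ x‖ ^ 2 : ℝ) : ℂ) - (α : ℂ)) * φ x)
    (hnontriv : ∃ x, φ x ≠ 0) :
    0 < P * R - α * β ∧ 0 < μ := by
  obtain ⟨x0, hx0⟩ := hnontriv
  have hd1 : ∀ x, HasDerivAt φ (deriv φ x) x := fun x =>
    ((hsmooth.differentiable (by norm_num)) x).hasDerivAt
  have hd2 : ∀ x, HasDerivAt (deriv φ) (deriv (deriv φ) x) x := fun x =>
    ((hsmooth.differentiable_deriv_two) x).hasDerivAt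
  have hper' : ∀ x, deriv φ (x + L) = deriv φ x := by
    intro x
    rw [← deriv_comp_add_const, funext hper]
  have re' : ∀ (ψ : ℝ → ℂ) (d : ℂ) (x : ℝ), HasDerivAt ψ d x →
      HasDerivAt (fun y => (ψ y).re) d.re x := fun ψ d x h =>
    Complex.reCLM.hasFDerivAt.comp_hasDerivAt x h
  have im' : ∀ (ψ : ℝ → ℂ) (d : ℂ) (x : ℝ), HasDerivAt ψ d x →
      HasDerivAt (fun y => (ψ y).im) d.im x := fun ψ d x h =>
    Complex.imCLM.hasFDerivAt.comp_hasDerivAt x h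
  have hs : ∀ x, ‖φ x‖ ^ 2 = (φ x).re ^ 2 + (φ x).im ^ 2 := by
    intro x; rw [Complex.sq_norm, Complex.normSq_apply]; ring
  have hs0 : 0 < ‖φ x0‖ ^ 2 := by positivity
  have hD : ∀ x, 0 < β + R * ‖φ x‖ ^ 2 := fun x => by positivity
  have key : ∀ x, deriv (deriv φ) x =
      ((2 * (g * ‖φ x‖ ^ 2 + lam * P / (β + R * ‖φ x‖ ^ 2) - μ) : ℝ) : ℂ) * φ x
      + ((P * R / (β + R * ‖φ x‖ ^ 2) - α : ℝ) : ℂ) * Complex.I * φ x := by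
    intro x
    have h := heq x
    push_cast at h ⊢
    linear_combination 2 * h
  have kre : ∀ x, (deriv (deriv φ) x).re =
      (2 * (g * ‖φ x‖ ^ 2 + lam * P / (β + R * ‖φ x‖ ^ 2) - μ)) * (φ x).re
      - (P * R / (β + R * ‖φ x‖ ^ 2) - α) * (φ x).im := by
    intro x
    rw [key x, Complex.add_re, mul_assoc, Complex.re_ofReal_mul, Complex.re_ofReal_mul,
      Complex.I_mul_re]; ring
  have kim : ∀ x, (deriv (deriv φ) x).im =
      (2 * (g * ‖φ x‖ ^ 2 + lam * P / (β + R * ‖φ x‖ ^ 2) - μ)) * (φ x).im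
      + (P * R / (β + R * ‖φ x‖ ^ 2) - α) * (φ x).re := by
    intro x
    rw [key x, Complex.add_im, mul_assoc, Complex.im_ofReal_mul, Complex.im_ofReal_mul,
      Complex.I_mul_im]
  constructor
  · by_contra hcon
    have hneg : ∀ x, α - P * R / (β + R * ‖φ x‖ ^ 2) =
        ((α * β - P * R) + α * R * ‖φ x‖ ^ 2) / (β + R * ‖φ x‖ ^ 2) := by
      intro x
      have := (hD x).ne'
      field_simp; ring
    have hnn : 0 ≤ α * β - P * R := by linarith
    have h := aux_periodic
      (fun x => (φ x).im * (deriv φ x).re - (φ x).re * (deriv φ x).im)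
      (fun x => (α - P * R / (β + R * ‖φ x‖ ^ 2)) * ‖φ x‖ ^ 2) L hL
      (fun x => by simp only [hper, hper'])
      (fun x => by
        refine (((im' _ _ _ (hd1 x)).mul (re' _ _ _ (hd2 x))).sub
          ((re' _ _ _ (hd1 x)).mul (im' _ _ _ (hd2 x)))).congr_deriv ?_
        rw [kre, kim]
        linear_combination (-(α - P * R / (β + R * ‖φ x‖ ^ 2))) * hs x)
      (fun x => by
        have := hD x
        simp only [hneg]
        positivity) x0
    have := hD x0
    simp only [hneg] at h
    have : 0 < ((α * β - P * R) + α * R * ‖φ x0‖ ^ 2) / (β + R * ‖φ x0‖ ^ 2) * ‖φ x0‖ ^ 2 := by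
      have h3 : 0 < α * R * ‖φ x0‖ ^ 2 := by positivity
      have h4 : 0 < (α * β - P * R) + α * R * ‖φ x0‖ ^ 2 := by linarith
      exact mul_pos (div_pos h4 this) hs0
    linarith
  · by_contra hcon
    have hnn : 0 ≤ -μ := by linarith
    have hq : ∀ x, 0 < lam * P / (β + R * ‖φ x‖ ^ 2) := fun x =>
      div_pos (mul_pos hlam hP) (hD x)
    have hc : ∀ x, 0 < g * ‖φ x‖ ^ 2 + lam * P / (β + R * ‖φ x‖ ^ 2) - μ := by
      intro x
      have h1 := hq x
      have h2 : 0 ≤ g * ‖φ x‖ ^ 2 := by positivity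
      linarith
    have h := aux_periodic
      (fun x => (φ x).re * (deriv φ x).re + (φ x).im * (deriv φ x).im)
      (fun x => (deriv φ x).re ^ 2 + (deriv φ x).im ^ 2 +
        2 * (g * ‖φ x‖ ^ 2 + lam * P / (β + R * ‖φ x‖ ^ 2) - μ) * ‖φ x‖ ^ 2) L hL
      (fun x => by simp only [hper, hper'])
      (fun x => by
        refine (((re' _ _ _ (hd1 x)).mul (re' _ _ _ (hd2 x))).add
          ((im' _ _ _ (hd1 x)).mul (im' _ _ _ (hd2 x)))).congr_deriv ?_
        rw [kre, kim]
        linear_combination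
          (-(2 * (g * ‖φ x‖ ^ 2 + lam * P / (β + R * ‖φ x‖ ^ 2) - μ))) * hs x)
      (fun x => by
        have := hc x
        positivity) x0
    have h5 := mul_pos (hc x0) hs0
    nlinarith [sq_nonneg (deriv φ x0).re, sq_nonneg (deriv φ x0).im]
end
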